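/- Let v₁ < v₂ < v₃ < v₄ be positive integers with gcd(v₁, v₂, v₃, v₄) = 1, and suppose some two of the speeds are both divisible by 3. Then ML(v₁, v₂, v₃, v₄) ≥ 1/4, unless (v₁, v₂, v₃) = (1, 2, 3) and v₄ = 12k for some positive integer k. -/

import Mathlib

/-- `dnn x` is the distance from `x` to the nearest integer:
`dnn x = min_{m : ℤ} |x - m|`. -/
noncomputable def dnn (x : ℝ) : ℝ := ⨅ m : ℤ, |x - m|

/-- The maximum loneliness of speeds `v 0, …, v (n-1)`:
`ML v = sup_{t : ℝ} min_{i} dnn (t * v i)`. -/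
noncomputable def ML {n : ℕ} (v : Fin n → ℝ) : ℝ := ⨆ t : ℝ, ⨅ i, dnn (t * v i)

/-- `x` is at distance at least `1/4` from the integers. -/
def G (x : ℝ) : Prop := ∃ m : ℤ, (m : ℝ) + 1 / 4 ≤ x ∧ x ≤ m + 3 / 4

lemma G.add_int {x : ℝ} (h : G x) (n : ℤ) : G (x + n) := by
  obtain ⟨m, h1, h2⟩ := h
  exact ⟨m + n, by push_cast; linarith, by push_cast; linarith⟩

lemma G.neg {x : ℝ} (h : G x) : G (-x) := by
  obtain ⟨m, h1, h2⟩ := h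
  exact ⟨-m - 1, by push_cast; linarith, by push_cast; linarith⟩

lemma G.of_eq {x y : ℝ} (h : G x) (n : ℤ) (e : y = x + n) : G y := e ▸ h.add_int n

lemma not_G {x : ℝ} (h : ¬ G x) : ∃ m : ℤ, |x - m| < 1 / 4 := by
  refine ⟨round x, ?_⟩
  have h1 := abs_le.1 (abs_sub_round x)
  by_contra hc
  apply h
  rcases le_abs.1 (not_lt.1 hc) with h2 | h2
  · exact ⟨round x, by linarith, by linarith [h1.2]⟩
  · exact ⟨round x - 1, by push_cast; linarith [h1.1], by push_cast; linarith⟩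

lemma G_or_half (x : ℝ) : G x ∨ G (x + 1 / 2) := by
  by_cases h : G x
  · exact Or.inl h
  · right
    obtain ⟨m, hm⟩ := not_G h
    have := abs_lt.1 hm
    exact ⟨m, by linarith [this.1], by linarith [this.2]⟩

lemma G_interval {x y : ℝ} (h : x + 1 / 2 ≤ y) : ∃ z, x ≤ z ∧ z ≤ y ∧ G z := by
  by_cases hx : G x
  · exact ⟨x, le_refl _, by linarith, hx⟩
  · obtain ⟨m, hm⟩ := not_G hx
    have := abs_lt.1 hm
    exact ⟨m + 1 / 4, by linarith [this.2], by linarith [this.1], m, le_refl _, by linarith⟩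

lemma prog {ρ δ : ℝ} (hδ : |δ| ≤ 1 / 2) (N : ℕ) (h : ∀ i : ℕ, i ≤ N → ¬ G (ρ + i * δ)) :
    N * |δ| < 1 / 2 := by
  obtain ⟨m, hm⟩ := not_G (h 0 (Nat.zero_le _))
  have key : ∀ i : ℕ, i ≤ N → |ρ + i * δ - m| < 1 / 4 := by
    intro i
    induction i with
    | zero => intro _; simpa using hm
    | succ i ih =>
      intro hi
      have h1 := abs_lt.1 (ih (by omega))
      obtain ⟨m', hm'⟩ := not_G (h (i + 1) hi)
      have h2 := abs_lt.1 hm'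
      have h3 := abs_le.1 hδ
      push_cast at h2 ⊢
      have a1 : ((m' : ℝ)) < m + 1 := by linarith [h1.1, h1.2, h2.1, h2.2, h3.1, h3.2]
      have a2 : ((m : ℝ)) < m' + 1 := by linarith [h1.1, h1.2, h2.1, h2.2, h3.1, h3.2]
      have a3 : m' < m + 1 := by exact_mod_cast a1
      have a4 : m < m' + 1 := by exact_mod_cast a2
      have : m' = m := by omega
      subst this
      exact abs_lt.2 h2
  have h0 := abs_lt.1 (key 0 (Nat.zero_le _))
  have hN := abs_lt.1 (key N le_rfl)
  have : |(N : ℝ) * δ| < 1 / 2 := by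
    rw [abs_lt]
    simp at h0
    constructor <;> linarith [h0.1, h0.2, hN.1, hN.2]
  rwa [abs_mul, Nat.abs_cast] at this

lemma shift (ρ δ : ℝ) (hδ : ∀ n : ℤ, δ ≠ n) : ∃ j : ℕ, G (ρ + j * δ) := by
  by_contra hc
  push Not at hc
  set δ' := δ - round δ with hd
  have h0 : 0 < |δ'| := abs_pos.2 (sub_ne_zero.2 (hδ _))
  obtain ⟨N, hN⟩ := exists_nat_gt (1 / 2 / |δ'|)
  have := prog (ρ := ρ) (abs_sub_round δ) N (by
    intro i _ hG
    apply hc i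
    exact hG.of_eq (i * round δ) (by push_cast; ring))
  rw [div_lt_iff₀ h0] at hN
  linarith

/-- shifting along `p/q` with `q` not dividing `p`. -/
lemma shiftZ (ρ : ℝ) (p q : ℤ) (hq : 0 < q) (h : ¬ q ∣ p) : ∃ j : ℕ, G (ρ + j * (p / q)) := by
  apply shift
  intro n hn
  apply h
  have : (q : ℝ) ≠ 0 := by exact_mod_cast hq.ne'
  rw [div_eq_iff this] at hn
  exact ⟨n, by rw [mul_comm]; exact_mod_cast hn⟩

lemma cover (ρ u : ℝ) (c m : ℤ) (hm : 0 < m) (h : IsCoprime c m) :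
    ∃ k n : ℤ, u ≤ ρ + c * k / m - n ∧ ρ + c * k / m - n ≤ u + 1 / m := by
  obtain ⟨x, y, hxy⟩ := h
  have hm' : (0 : ℝ) < m := by exact_mod_cast hm
  have e : (x : ℝ) * c + y * m = 1 := by exact_mod_cast hxy
  set j := ⌈(u - ρ) * m⌉ with hj
  have h1 : (u - ρ) * m ≤ j := Int.le_ceil _
  have h2 : (j : ℝ) < (u - ρ) * m + 1 := Int.ceil_lt_add_one _
  have h3 : ρ + (c : ℝ) * ((x * j : ℤ) : ℝ) / m - ((-(y * j) : ℤ) : ℝ) = ρ + j / m := by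
    push_cast
    field_simp
    linear_combination (j : ℝ) * e
  refine ⟨x * j, -(y * j), ?_, ?_⟩
  · rw [h3]
    have : u - ρ ≤ j / m := by rwa [le_div_iff₀ hm']
    linarith
  · rw [h3]
    have : (j : ℝ) / m ≤ u - ρ + 1 / m := by
      rw [div_le_iff₀ hm', add_mul, one_div, inv_mul_cancel₀ hm'.ne']
      exact h2.le
    linarith

lemma G_of_res (v : ℤ) (r p q : ℕ) (hv : (q : ℤ) ∣ v - r) (hq : 0 < q)
    (h1 : q ≤ 4 * (r * p % q)) (h2 : 4 * (r * p % q) ≤ 3 * q) : G ((v : ℝ) * (p / q)) := by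
  obtain ⟨w, hw⟩ := hv
  have hq' : (0 : ℝ) < q := by exact_mod_cast hq
  have e1 : (v : ℝ) = r + q * w := by
    have : v = r + q * w := by linarith
    exact_mod_cast this
  have e2' := (Nat.div_add_mod (r * p) q).symm
  generalize r * p / q = Q at e2'
  generalize r * p % q = R at e2' h1 h2
  have e2 : (r : ℝ) * p = q * Q + R := by exact_mod_cast e2'
  have e3 : (v : ℝ) * (p / q) = (R : ℝ) / q + ((w * p + Q : ℤ) : ℝ) := by
    rw [e1]
    push_cast
    field_simp
    linear_combination e2
  have h1' : (q : ℝ) ≤ 4 * (R : ℝ) := by exact_mod_cast h1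
  have h2' : 4 * (R : ℝ) ≤ 3 * (q : ℝ) := by exact_mod_cast h2
  rw [e3]
  apply G.add_int
  refine ⟨0, ?_, ?_⟩
  · rw [le_div_iff₀ hq']; push_cast; linarith
  · rw [div_le_iff₀ hq']; push_cast; linarith

/-- Two runners. -/
lemma lr2 (a b : ℕ) (ha : 0 < a) (hb : 0 < b) : ∃ t : ℝ, G (a * t) ∧ G (b * t) := by
  obtain ⟨j, hj⟩ := shiftZ 0 a (a + b) (by positivity) (by
    intro h
    have := Int.le_of_dvd (by positivity) h
    omega)
  have h0 : ((a : ℝ) + b) ≠ 0 := by positivity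
  push_cast at hj
  refine ⟨j / (a + b), hj.of_eq 0 (by push_cast; ring), hj.neg.of_eq j ?_⟩
  push_cast
  field_simp
  ring

/-- Three runners, one even speed and two odd speeds. -/
lemma lr3_one (a b c : ℕ) (ha : 0 < a) (hea : Even a) (hb : Odd b) (hc : Odd c) :
    ∃ t : ℝ, G (a * t) ∧ G (b * t) ∧ G (c * t) := by
  obtain ⟨a', ha'⟩ := hea
  obtain ⟨b', hb'⟩ := hb
  obtain ⟨c', hc'⟩ := hc
  have ha0 : (0 : ℝ) < a := by exact_mod_cast ha
  have hae : (a : ℝ) = a' + a' := by exact_mod_cast ha'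
  have hbe : (b : ℝ) = 2 * b' + 1 := by exact_mod_cast hb'
  have hce : (c : ℝ) = 2 * c' + 1 := by exact_mod_cast hc'
  by_cases h : b ≤ a ∧ c ≤ a
  · have q : ∀ x : ℕ, ∀ x' : ℕ, x ≤ a → (x : ℝ) = 2 * x' + 1 → G (x * (1 / 2 + 1 / (4 * a))) := by
      intro x x' hx hxe
      have hx' : (x : ℝ) ≤ a := by exact_mod_cast hx
      have h1 : (x : ℝ) * (1 / (4 * a)) ≤ 1 / 4 := by
        rw [mul_one_div, div_le_iff₀ (by positivity)]; linarith
      have h0 : 0 ≤ (x : ℝ) * (1 / (4 * a)) := by positivity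
      refine ⟨x', ?_, ?_⟩ <;> rw [mul_add] <;> push_cast <;> linarith
    refine ⟨1 / 2 + 1 / (4 * a), ⟨a', ?_, ?_⟩, q b b' h.1 hbe, q c c' h.2 hce⟩
    · have : (a : ℝ) * (1 / (4 * a)) = 1 / 4 := by field_simp
      rw [mul_add, this]; push_cast; linarith
    · have : (a : ℝ) * (1 / (4 * a)) = 1 / 4 := by field_simp
      rw [mul_add, this]; push_cast; linarith
  · have hlt : a < b + c := by omega
    obtain ⟨j, hj⟩ := shiftZ 0 a (b + c) (by omega) (by
      intro h
      have := Int.le_of_dvd (by omega) h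
      omega)
    have h0 : ((b : ℝ) + c) ≠ 0 := by rw [hbe, hce]; positivity
    push_cast at hj
    rcases G_or_half (b * (j / (b + c))) with h1 | h1
    · refine ⟨j / (b + c), hj.of_eq 0 (by push_cast; ring), h1, h1.neg.of_eq j ?_⟩
      push_cast
      field_simp
      ring
    · refine ⟨j / (b + c) + 1 / 2, hj.of_eq a' ?_, h1.of_eq b' ?_, h1.neg.of_eq (j + c' + 1) ?_⟩
      · rw [hae]; push_cast; ring
      · push_cast; rw [mul_add, hbe]; ring
      · push_cast
        have e : (c : ℝ) * (j / (b + c)) = j - b * (j / (b + c)) := by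
          field_simp; ring
        rw [mul_add, e]
        linarith

/-- Three runners, two even speeds and one odd speed. -/
lemma lr3_two (a b c : ℕ) (ha : 0 < a) (hb : 0 < b) (hea : Even a) (heb : Even b) (hc : Odd c) :
    ∃ t : ℝ, G (a * t) ∧ G (b * t) ∧ G (c * t) := by
  obtain ⟨t, h1, h2⟩ := lr2 a b ha hb
  obtain ⟨a', ha'⟩ := hea
  obtain ⟨b', hb'⟩ := heb
  obtain ⟨c', hc'⟩ := hc
  have hae : (a : ℝ) = a' + a' := by exact_mod_cast ha'
  have hbe : (b : ℝ) = b' + b' := by exact_mod_cast hb'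
  have hce : (c : ℝ) = 2 * c' + 1 := by exact_mod_cast hc'
  rcases G_or_half (c * t) with h | h
  · exact ⟨t, h1, h2, h⟩
  · refine ⟨t + 1 / 2, h1.of_eq a' ?_, h2.of_eq b' ?_, h.of_eq c' ?_⟩
    · rw [hae]; push_cast; ring
    · rw [hbe]; push_cast; ring
    · rw [mul_add]; push_cast; linarith

/-- The lonely runner bound for three speeds. -/
lemma lr3 (a b c : ℕ) (ha : 0 < a) (hb : 0 < b) (hc : 0 < c) :
    ∃ t : ℝ, G (a * t) ∧ G (b * t) ∧ G (c * t) := by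
  induction a using Nat.strong_induction_on generalizing b c with
  | _ a ih =>
  rcases Nat.even_or_odd a with h1 | h1 <;> rcases Nat.even_or_odd b with h2 | h2 <;>
    rcases Nat.even_or_odd c with h3 | h3
  · obtain ⟨a', ha'⟩ := h1
    obtain ⟨b', hb'⟩ := h2
    obtain ⟨c', hc'⟩ := h3
    have hae : (a : ℝ) = a' + a' := by exact_mod_cast ha'
    have hbe : (b : ℝ) = b' + b' := by exact_mod_cast hb'
    have hce : (c : ℝ) = c' + c' := by exact_mod_cast hc'
    obtain ⟨t, g1, g2, g3⟩ := ih a' (by omega) b' c' (by omega) (by omega) (by omega)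
    exact ⟨t / 2, g1.of_eq 0 (by rw [hae]; push_cast; ring),
      g2.of_eq 0 (by rw [hbe]; push_cast; ring), g3.of_eq 0 (by rw [hce]; push_cast; ring)⟩
  · exact lr3_two a b c ha hb h1 h2 h3
  · obtain ⟨t, g1, g2, g3⟩ := lr3_two a c b ha hc h1 h3 h2
    exact ⟨t, g1, g3, g2⟩
  · exact lr3_one a b c ha h1 h2 h3
  · obtain ⟨t, g1, g2, g3⟩ := lr3_two b c a hb hc h2 h3 h1
    exact ⟨t, g3, g1, g2⟩
  · obtain ⟨t, g1, g2, g3⟩ := lr3_one b a c hb h2 h1 h3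
    exact ⟨t, g2, g1, g3⟩
  · obtain ⟨t, g1, g2, g3⟩ := lr3_one c a b hc h3 h1 h2
    exact ⟨t, g2, g3, g1⟩
  · have q : ∀ x : ℕ, Odd x → G (x * (1 / 2)) := by
      rintro x ⟨x', hx⟩
      have hxe : (x : ℝ) = 2 * x' + 1 := by exact_mod_cast hx
      refine ⟨x', ?_, ?_⟩ <;> push_cast <;> linarith
    exact ⟨1 / 2, q a h1, q b h2, q c h3⟩

lemma G_natAbs (c : ℤ) (t : ℝ) (h : G ((c.natAbs : ℝ) * t)) : G (c * t) := by
  have e1 : ((c.natAbs : ℤ) : ℝ) = (c.natAbs : ℝ) := Int.cast_natCast _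
  rcases Int.natAbs_eq c with e | e
  · rw [e, e1]
    exact h
  · rw [e, Int.cast_neg, e1, neg_mul]
    exact h.neg

lemma lr3Z (a b c : ℤ) (ha : a ≠ 0) (hb : b ≠ 0) (hc : c ≠ 0) :
    ∃ t : ℝ, G (a * t) ∧ G (b * t) ∧ G (c * t) := by
  obtain ⟨t, h1, h2, h3⟩ := lr3 a.natAbs b.natAbs c.natAbs (by omega) (by omega) (by omega)
  exact ⟨t, G_natAbs _ _ h1, G_natAbs _ _ h2, G_natAbs _ _ h3⟩

lemma one_theta (m : ℤ) (hm : 2 ≤ m) : ∃ θ : ℝ, |θ| ≤ 1 / 6 ∧ G (m * θ) := by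
  have hm' : (2 : ℝ) ≤ m := by exact_mod_cast hm
  have h0 : (0 : ℝ) < 4 * m := by linarith
  refine ⟨1 / (4 * m), ?_, 0, ?_, ?_⟩
  · rw [abs_of_nonneg (by positivity), div_le_div_iff₀ h0 (by norm_num)]
    linarith
  · have : (m : ℝ) * (1 / (4 * m)) = 1 / 4 := by field_simp
    rw [this]; norm_num
  · have : (m : ℝ) * (1 / (4 * m)) = 1 / 4 := by field_simp
    rw [this]; norm_num

lemma two_theta (m n : ℤ) (hm : 2 ≤ m) (hmn : m ≤ n) (h : ¬ (m = 2 ∧ n = 7)) :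
    ∃ θ : ℝ, |θ| ≤ 1 / 6 ∧ G (m * θ) ∧ G (n * θ) := by
  have hm' : (2 : ℝ) ≤ m := by exact_mod_cast hm
  have hmn' : (m : ℝ) ≤ n := by exact_mod_cast hmn
  have h0 : (0 : ℝ) < 4 * m := by linarith
  have hn0 : (0 : ℝ) < n := by linarith
  have hm0 : (0 : ℝ) < m := by linarith
  have e : (m : ℝ) * (1 / (4 * m)) = 1 / 4 := by field_simp
  have h8 : 1 / (4 * (m : ℝ)) ≤ 1 / 8 := by
    rw [div_le_div_iff₀ h0 (by norm_num)]; linarith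
  -- general interval principle
  have gen : ∀ T : ℝ, T ≤ 1 / 6 → m * T ≤ 3 / 4 → n * (1 / (4 * m)) + 1 / 2 ≤ n * T →
      ∃ θ : ℝ, |θ| ≤ 1 / 6 ∧ G (m * θ) ∧ G (n * θ) := by
    intro T hT1 hT2 hT3
    obtain ⟨z, hz1, hz2, hz3⟩ := G_interval hT3
    have a1 : 1 / (4 * (m : ℝ)) ≤ z / n := by rw [le_div_iff₀ hn0]; linarith
    have a2 : z / n ≤ T := by rw [div_le_iff₀ hn0]; linarith
    have a0 : 0 ≤ 1 / (4 * (m : ℝ)) := by positivity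
    refine ⟨z / n, ?_, ⟨0, ?_, ?_⟩, ?_⟩
    · rw [abs_of_nonneg (by linarith)]; linarith
    · have := mul_le_mul_of_nonneg_left a1 hm0.le
      push_cast; linarith
    · have := mul_le_mul_of_nonneg_left a2 hm0.le
      push_cast; linarith
    · rwa [mul_div_cancel₀ _ hn0.ne']
  by_cases h3 : n ≤ 3 * m
  · have h3' : (n : ℝ) ≤ 3 * m := by exact_mod_cast h3
    refine ⟨1 / (4 * m), ?_, ⟨0, ?_, ?_⟩, 0, ?_, ?_⟩
    · rw [abs_of_nonneg (by positivity)]; linarith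
    · rw [e]; norm_num
    · rw [e]; norm_num
    · rw [mul_one_div, le_div_iff₀ h0]; push_cast; linarith
    · rw [mul_one_div, div_le_iff₀ h0]; push_cast; linarith
  have h3' : (3 : ℝ) * m < n := by exact_mod_cast (not_le.1 h3)
  by_cases h5 : 5 ≤ m
  · have h5' : (5 : ℝ) ≤ m := by exact_mod_cast h5
    apply gen (3 / (4 * m))
    · rw [div_le_div_iff₀ h0 (by norm_num)]; linarith
    · apply le_of_eq; field_simp
    · have : (n : ℝ) * (3 / (4 * m)) = n * (1 / (4 * m)) + (n / m) / 2 := by field_simp; ring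
      rw [this]
      have : 1 ≤ (n : ℝ) / m := by rw [le_div_iff₀ hm0]; linarith
      linarith
  have hm4 : m = 2 ∨ m = 3 ∨ m = 4 := by omega
  rcases hm4 with rfl | rfl | rfl
  · by_cases h12 : 12 ≤ n
    · have h12' : (12 : ℝ) ≤ n := by exact_mod_cast h12
      apply gen (1 / 6) <;> push_cast <;> linarith
    · have : n = 8 ∨ n = 9 ∨ n = 10 ∨ n = 11 := by omega
      rcases this with rfl | rfl | rfl | rfl
      · exact ⟨1 / 6, by rw [abs_of_nonneg] <;> norm_num, ⟨0, by norm_num, by norm_num⟩,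
          ⟨1, by norm_num, by norm_num⟩⟩
      · exact ⟨1 / 6, by rw [abs_of_nonneg] <;> norm_num, ⟨0, by norm_num, by norm_num⟩,
          ⟨1, by norm_num, by norm_num⟩⟩
      · exact ⟨1 / 6, by rw [abs_of_nonneg] <;> norm_num, ⟨0, by norm_num, by norm_num⟩,
          ⟨1, by norm_num, by norm_num⟩⟩
      · exact ⟨1 / 8, by rw [abs_of_nonneg] <;> norm_num, ⟨0, by norm_num, by norm_num⟩,
          ⟨1, by norm_num, by norm_num⟩⟩
  · push_cast at h3'
    apply gen (1 / 6) <;> push_cast <;> linarith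
  · push_cast at h3'
    apply gen (1 / 6) <;> push_cast <;> linarith

/-- The special case `e = 5`, `b ≡ 2 a`. -/
lemma core5 (a b A y w : ℤ) (hA : a * A = 1 + 5 * y) (hb : b * A = 2 + 5 * w) :
    ∃ s : ℝ, G (a * s) ∧ G (b * s) ∧ ∃ n : ℤ, |5 * s - n| ≤ 1 / 6 := by
  have ha0 : a ≠ 0 := by rintro rfl; omega
  have hb0 : b ≠ 0 := by rintro rfl; omega
  have hA' : (a : ℝ) * A = 1 + 5 * y := by exact_mod_cast hA
  have hb' : (b : ℝ) * A = 2 + 5 * w := by exact_mod_cast hb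
  have hn : ¬ (|a| ≤ 1 ∧ |b| ≤ 1) := by
    rintro ⟨h1, h2⟩
    rw [abs_le] at h1 h2
    have ha1 : a = 1 ∨ a = -1 := by omega
    have hb1 : b = 1 ∨ b = -1 := by omega
    rcases ha1 with rfl | rfl <;> rcases hb1 with rfl | rfl <;> omega
  have haR : (a : ℝ) ≠ 0 := by exact_mod_cast ha0
  have hbR : (b : ℝ) ≠ 0 := by exact_mod_cast hb0
  by_cases hab : |a| ≤ |b|
  · have h2 : (2 : ℝ) ≤ |(b : ℝ)| := by
      have : 2 ≤ |b| := by omega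
      exact_mod_cast this
    have hab' : |(a : ℝ)| ≤ |(b : ℝ)| := by exact_mod_cast hab
    have hθ : |1 / (4 * (b : ℝ))| ≤ 1 / 6 := by
      rw [abs_div, abs_mul, abs_one, div_le_div_iff₀ (by positivity) (by norm_num)]
      norm_num; linarith
    have haθ : |(a : ℝ) * (1 / (4 * b))| ≤ 1 / 4 := by
      rw [mul_one_div, abs_div, abs_mul, div_le_div_iff₀ (by positivity) (by norm_num)]
      norm_num; linarith
    have hbθ : (b : ℝ) * (1 / (4 * b)) = 1 / 4 := by field_simp
    have haθ' := abs_le.1 haθ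
    refine ⟨(A * 3 + 1 / (4 * b)) / 5, ⟨3 * y, ?_, ?_⟩, ⟨1 + 3 * w, ?_, ?_⟩, A * 3, ?_⟩
    · have : (a : ℝ) * ((A * 3 + 1 / (4 * b)) / 5) = (3 * (a * A) + a * (1 / (4 * b))) / 5 := by ring
      rw [this, hA']; push_cast; linarith [haθ'.1]
    · have : (a : ℝ) * ((A * 3 + 1 / (4 * b)) / 5) = (3 * (a * A) + a * (1 / (4 * b))) / 5 := by ring
      rw [this, hA']; push_cast; linarith [haθ'.2]
    · have : (b : ℝ) * ((A * 3 + 1 / (4 * b)) / 5) = (3 * (b * A) + b * (1 / (4 * b))) / 5 := by ring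
      rw [this, hb', hbθ]; push_cast; linarith
    · have : (b : ℝ) * ((A * 3 + 1 / (4 * b)) / 5) = (3 * (b * A) + b * (1 / (4 * b))) / 5 := by ring
      rw [this, hb', hbθ]; push_cast; linarith
    · have : 5 * (((A : ℝ) * 3 + 1 / (4 * b)) / 5) - ((A * 3 : ℤ) : ℝ) = 1 / (4 * b) := by
        push_cast; ring
      rw [this]; exact hθ
  · have h2 : (2 : ℝ) ≤ |(a : ℝ)| := by
      have : 2 ≤ |a| := by omega
      exact_mod_cast this
    have hab' : |(b : ℝ)| ≤ |(a : ℝ)| := by exact_mod_cast (not_le.1 hab).le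
    have hθ : |1 / (4 * (a : ℝ))| ≤ 1 / 6 := by
      rw [abs_div, abs_mul, abs_one, div_le_div_iff₀ (by positivity) (by norm_num)]
      norm_num; linarith
    have hbθ : |(b : ℝ) * (1 / (4 * a))| ≤ 1 / 4 := by
      rw [mul_one_div, abs_div, abs_mul, div_le_div_iff₀ (by positivity) (by norm_num)]
      norm_num; linarith
    have haθ : (a : ℝ) * (1 / (4 * a)) = 1 / 4 := by field_simp
    have hbθ' := abs_le.1 hbθ
    refine ⟨(A * 1 + 1 / (4 * a)) / 5, ⟨y, ?_, ?_⟩, ⟨w, ?_, ?_⟩, A, ?_⟩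
    · have : (a : ℝ) * ((A * 1 + 1 / (4 * a)) / 5) = ((a * A) + a * (1 / (4 * a))) / 5 := by ring
      rw [this, hA', haθ]; push_cast; linarith
    · have : (a : ℝ) * ((A * 1 + 1 / (4 * a)) / 5) = ((a * A) + a * (1 / (4 * a))) / 5 := by ring
      rw [this, hA', haθ]; push_cast; linarith
    · have : (b : ℝ) * ((A * 1 + 1 / (4 * a)) / 5) = ((b * A) + b * (1 / (4 * a))) / 5 := by ring
      rw [this, hb']; push_cast; linarith [hbθ'.1]
    · have : (b : ℝ) * ((A * 1 + 1 / (4 * a)) / 5) = ((b * A) + b * (1 / (4 * a))) / 5 := by ring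
      rw [this, hb']; push_cast; linarith [hbθ'.2]
    · have : 5 * (((A : ℝ) * 1 + 1 / (4 * a)) / 5) - (A : ℝ) = 1 / (4 * a) := by ring
      rw [this]; exact hθ

/-- Balanced residue. -/
lemma balanced (x e : ℤ) (he : 0 < e) : ∃ r w : ℤ, x = r + e * w ∧ 2 * |r| ≤ e := by
  have h1 := Int.emod_nonneg x he.ne'
  have h2 := Int.emod_lt_of_pos x he
  have h3 := Int.emod_add_mul_ediv x e
  by_cases h : 2 * (x % e) ≤ e
  · exact ⟨x % e, x / e, h3.symm, by rw [abs_of_nonneg h1]; exact h⟩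
  · refine ⟨x % e - e, x / e + 1, by rw [mul_add]; linarith, ?_⟩
    rw [abs_of_neg (by linarith)]
    linarith

lemma coreA (a b e : ℤ) (he : 2 ≤ e) (ha : IsCoprime a e) (hb : IsCoprime b e) :
    ∃ s : ℝ, G (a * s) ∧ G (b * s) ∧ ∃ n : ℤ, |e * s - n| ≤ 1 / 6 := by
  obtain ⟨A, y, hA⟩ := ha
  obtain ⟨r, w, hr, hr2⟩ := balanced (b * A) e (by omega)
  have heR : (0 : ℝ) < e := by exact_mod_cast (by omega : 0 < e)
  have hA' : (A : ℝ) * a + y * e = 1 := by exact_mod_cast hA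
  have hr' : (b : ℝ) * A = r + e * w := by exact_mod_cast hr
  have hr0 : r ≠ 0 := by
    rintro rfl
    have h1 : IsCoprime A e := ⟨a, y, by linarith⟩
    have h2 : IsCoprime (b * A) e := IsCoprime.mul_left hb h1
    rw [hr, zero_add] at h2
    have : IsUnit e := by
      have h3 : e ∣ e * w := ⟨w, rfl⟩
      exact h2.isUnit_of_dvd' h3 dvd_rfl
    rcases Int.isUnit_iff.1 this with h | h <;> omega
  -- times `A k / e`
  have wint : ∀ k : ℤ, e ≤ 4 * k → 4 * k ≤ 3 * e → G (r * (k / e)) →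
      ∃ s : ℝ, G (a * s) ∧ G (b * s) ∧ ∃ n : ℤ, |e * s - n| ≤ 1 / 6 := by
    intro k h1 h2 h3
    have h1' : (e : ℝ) ≤ 4 * k := by exact_mod_cast h1
    have h2' : (4 : ℝ) * k ≤ 3 * e := by exact_mod_cast h2
    have g : G ((k : ℝ) / e) := by
      refine ⟨0, ?_, ?_⟩
      · rw [le_div_iff₀ heR]; push_cast; linarith
      · rw [div_le_iff₀ heR]; push_cast; linarith
    refine ⟨A * k / e, g.of_eq (-(y * k)) ?_, h3.of_eq (w * k) ?_, A * k, ?_⟩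
    · push_cast; field_simp; linear_combination (k : ℝ) * hA'
    · push_cast; field_simp; linear_combination (k : ℝ) * hr'
    · have : (e : ℝ) * (A * k / e) - ((A * k : ℤ) : ℝ) = 0 := by push_cast; field_simp; ring
      rw [this]; norm_num
  by_cases h1 : |r| = 1
  · have h0 : (e : ℝ) ≤ 4 * ((e + 3) / 4 : ℤ) := by exact_mod_cast (by omega : e ≤ 4 * ((e + 3) / 4))
    have h0' : (4 : ℝ) * ((e + 3) / 4 : ℤ) ≤ 3 * e := by
      exact_mod_cast (by omega : 4 * ((e + 3) / 4) ≤ 3 * e)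
    have g : G ((((e + 3) / 4 : ℤ) : ℝ) / e) := by
      refine ⟨0, ?_, ?_⟩
      · rw [le_div_iff₀ heR]; push_cast at *; linarith
      · rw [div_le_iff₀ heR]; push_cast at *; linarith
    apply wint ((e + 3) / 4) (by omega) (by omega)
    rcases (abs_eq (by norm_num)).1 h1 with rfl | rfl
    · simpa using g
    · have := g.neg
      simpa using this
  have hr3 : 2 ≤ |r| := by
    have := abs_pos.2 hr0
    omega
  by_cases h5 : e = 5
  · subst h5
    have : |r| = 2 := by omega
    rcases (abs_eq (by norm_num)).1 this with rfl | rfl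
    · obtain ⟨s, g1, g2, n, hn⟩ := core5 a b A (-y) w (by linarith) hr
      exact ⟨s, g1, g2, n, by push_cast; exact hn⟩
    · obtain ⟨s, g1, g2, n, hn⟩ := core5 a (-b) A (-y) (-w) (by linarith) (by linarith)
      refine ⟨s, g1, ?_, n, by push_cast; exact hn⟩
      have := g2.neg
      push_cast at this
      simpa using this
  have he6 : 6 ≤ e := by
    by_contra hc
    have h4 : e = 4 := by omega
    have : |r| = 2 := by omega
    subst h4
    obtain ⟨p, q, hpq⟩ := hb
    rcases (abs_eq (by norm_num)).1 this with rfl | rfl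
    · have h1 : 2 ∣ b * A := by omega
      rcases Int.prime_two.dvd_mul.1 h1 with ⟨x, hx⟩ | ⟨x, hx⟩
      · rw [hx] at hpq
        have : 2 * (p * x + 2 * q) = 1 := by linarith
        omega
      · rw [hx] at hA
        have : 2 * (a * x + 2 * y) = 1 := by linarith
        omega
    · have h1 : 2 ∣ b * A := by omega
      rcases Int.prime_two.dvd_mul.1 h1 with ⟨x, hx⟩ | ⟨x, hx⟩
      · rw [hx] at hpq
        have : 2 * (p * x + 2 * q) = 1 := by linarith
        omega
      · rw [hx] at hA
        have : 2 * (a * x + 2 * y) = 1 := by linarith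
        omega
  by_contra hc
  obtain ⟨k0, hk0⟩ : ∃ k0 : ℤ, k0 = (e + 3) / 4 := ⟨_, rfl⟩
  obtain ⟨N, hN⟩ : ∃ N : ℕ, (N : ℤ) = 3 * e / 4 - k0 := ⟨(3 * e / 4 - k0).toNat, by omega⟩
  have hδ : |(r : ℝ) / e| ≤ 1 / 2 := by
    rw [abs_div, abs_of_pos heR, div_le_div_iff₀ heR (by norm_num)]
    have : (2 : ℝ) * |(r : ℝ)| ≤ e := by exact_mod_cast hr2
    linarith
  have := prog (ρ := r * (k0 / e)) hδ N (by
    intro i hi hG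
    apply hc
    apply wint (k0 + i) (by omega) (by omega)
    refine hG.of_eq 0 ?_
    push_cast; ring)
  rw [abs_div, abs_of_pos heR, mul_div_assoc', div_lt_div_iff₀ heR (by norm_num)] at this
  have h7 : N * |r| * 2 < e := by
    have : (N : ℝ) * |(r : ℝ)| * 2 < 1 * e := this
    rw [one_mul] at this
    exact_mod_cast this
  have h8 : (N : ℤ) * 2 ≤ N * |r| := mul_le_mul_of_nonneg_left hr3 (by positivity)
  omega

/-- Two fixed speeds far from the integers and one close to the integers. -/
lemma lemmaA (a b e : ℤ) (ha : 0 < a) (hb : 0 < b) (he : 0 < e) (hae : a ≠ e) (hbe : b ≠ e)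
    (hx1 : ¬ (a = 2 * e ∧ b = 7 * e)) (hx2 : ¬ (a = 7 * e ∧ b = 2 * e)) :
    ∃ s : ℝ, G (a * s) ∧ G (b * s) ∧ ∃ n : ℤ, |e * s - n| ≤ 1 / 6 := by
  have heR : (0 : ℝ) < e := by exact_mod_cast he
  -- one of the speeds divisible by `e`
  have one : ∀ a b : ℤ, 0 < a → a ≠ e → e ∣ a → ¬ e ∣ b →
      ∃ s : ℝ, G (a * s) ∧ G (b * s) ∧ ∃ n : ℤ, |e * s - n| ≤ 1 / 6 := by
    rintro a b ha hae ⟨m, rfl⟩ hb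
    have hm0 : 0 < m := pos_of_mul_pos_right ha he.le
    have hm1 : m ≠ 1 := by rintro rfl; simp at hae
    obtain ⟨θ, h1, h2⟩ := one_theta m (by omega)
    obtain ⟨j, hj⟩ := shiftZ (b * (θ / e)) b e he hb
    refine ⟨(θ + j) / e, h2.of_eq (m * j) ?_, hj.of_eq 0 ?_, j, ?_⟩
    · push_cast; field_simp
    · push_cast; field_simp; ring
    · have : (e : ℝ) * ((θ + j) / e) - ((j : ℤ) : ℝ) = θ := by push_cast; field_simp; ring
      rw [this]; exact h1
  by_cases da : e ∣ a
  · by_cases db : e ∣ b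
    · obtain ⟨m, rfl⟩ := da
      obtain ⟨n, rfl⟩ := db
      have hm0 : 0 < m := pos_of_mul_pos_right ha he.le
      have hn0 : 0 < n := pos_of_mul_pos_right hb he.le
      have hm1 : m ≠ 1 := by rintro rfl; simp at hae
      have hn1 : n ≠ 1 := by rintro rfl; simp at hbe
      have h1 : ¬ (m = 2 ∧ n = 7) := by
        rintro ⟨rfl, rfl⟩; exact hx1 ⟨by ring, by ring⟩
      have h2 : ¬ (n = 2 ∧ m = 7) := by
        rintro ⟨rfl, rfl⟩; exact hx2 ⟨by ring, by ring⟩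
      have : ∃ θ : ℝ, |θ| ≤ 1 / 6 ∧ G (m * θ) ∧ G (n * θ) := by
        rcases le_total m n with h | h
        · exact two_theta m n (by omega) h h1
        · obtain ⟨θ, g0, g1, g2⟩ := two_theta n m (by omega) h h2
          exact ⟨θ, g0, g2, g1⟩
      obtain ⟨θ, g0, g1, g2⟩ := this
      refine ⟨θ / e, g1.of_eq 0 ?_, g2.of_eq 0 ?_, 0, ?_⟩
      · push_cast; field_simp; ring
      · push_cast; field_simp; ring
      · have : (e : ℝ) * (θ / e) - ((0 : ℤ) : ℝ) = θ := by push_cast; field_simp; ring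
        rw [this]; exact g0
    · exact one a b ha hae da db
  by_cases db : e ∣ b
  · obtain ⟨s, g1, g2, g3⟩ := one b a hb hbe db da
    exact ⟨s, g2, g1, g3⟩
  -- neither divisible
  have two : ∀ a b : ℤ, ¬ e ∣ a → ¬ ((Int.gcd a e : ℤ) ∣ b) →
      ∃ s : ℝ, G (a * s) ∧ G (b * s) ∧ ∃ n : ℤ, |e * s - n| ≤ 1 / 6 := by
    intro a b da hg
    obtain ⟨k, hk⟩ := shiftZ 0 a e he da
    have hgpos : (0 : ℤ) < Int.gcd a e := by
      exact_mod_cast Int.gcd_pos_of_ne_zero_right a he.ne'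
    obtain ⟨a1, ha1⟩ := Int.gcd_dvd_left a e
    obtain ⟨e1, he1⟩ := Int.gcd_dvd_right a e
    obtain ⟨j, hj⟩ := shiftZ (b * (k / e)) b (Int.gcd a e) hgpos hg
    generalize (Int.gcd a e : ℤ) = g at *
    have hgR : (0 : ℝ) < g := by exact_mod_cast hgpos
    have ha1' : (a : ℝ) = g * a1 := by exact_mod_cast ha1
    have he1' : (e : ℝ) = g * e1 := by exact_mod_cast he1
    refine ⟨k / e + j / g, hk.of_eq (j * a1) ?_, hj.of_eq 0 ?_, k + j * e1, ?_⟩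
    · have : (a : ℝ) * (j / g) = j * a1 := by rw [ha1']; field_simp
      push_cast; rw [mul_add, this]; ring
    · push_cast; ring
    · have h2 : (e : ℝ) * (j / g) = j * e1 := by rw [he1']; field_simp
      have h3 : (e : ℝ) * (k / e) = k := by field_simp
      rw [mul_add, h2, h3]; push_cast
      rw [sub_self]; norm_num
  by_cases h1 : (Int.gcd a e : ℤ) ∣ b
  swap
  · exact two a b da h1
  by_cases h2 : (Int.gcd b e : ℤ) ∣ a
  swap
  · obtain ⟨s, g1, g2, g3⟩ := two b a db h2
    exact ⟨s, g2, g1, g3⟩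
  have heq : Int.gcd a e = Int.gcd b e := by
    apply Nat.dvd_antisymm
    · exact Int.dvd_gcd h1 (Int.gcd_dvd_right a e)
    · exact Int.dvd_gcd h2 (Int.gcd_dvd_right b e)
  have hgpos : 0 < Int.gcd a e := Int.gcd_pos_of_ne_zero_right a he.ne'
  obtain ⟨a1, e1, hc1, ha1, he1⟩ := Int.exists_gcd_one hgpos
  have hgpos' : 0 < Int.gcd b e := heq ▸ hgpos
  obtain ⟨b1, e2, hc2, hb1, he2⟩ := Int.exists_gcd_one hgpos'
  rw [← heq] at hb1 he2
  generalize Int.gcd a e = g at *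
  have hgZ : (0 : ℤ) < g := by exact_mod_cast hgpos
  have : e1 = e2 := by
    have : e1 * (g : ℤ) = e2 * g := by rw [← he1, ← he2]
    exact mul_right_cancel₀ hgZ.ne' this
  subst this
  have he10 : 0 < e1 := by
    rw [he1] at he
    exact pos_of_mul_pos_left he hgZ.le
  have he11 : e1 ≠ 1 := by
    rintro rfl
    apply da
    rw [he1, ha1, one_mul]
    exact ⟨a1, mul_comm _ _⟩
  obtain ⟨s, g1, g2, n, hn⟩ := coreA a1 b1 e1 (by omega) (Int.isCoprime_iff_gcd_eq_one.2 hc1)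
    (Int.isCoprime_iff_gcd_eq_one.2 hc2)
  have hgR : (0 : ℝ) < g := by exact_mod_cast hgpos
  refine ⟨s / g, g1.of_eq 0 ?_, g2.of_eq 0 ?_, n, ?_⟩
  · rw [ha1]; push_cast; field_simp; ring
  · rw [hb1]; push_cast; field_simp; ring
  · have : (e : ℝ) * (s / g) = e1 * s := by rw [he1]; push_cast; field_simp
    rw [this]; exact hn

/-- All four speeds can be far from the integers simultaneously. -/
def W (a b c d : ℤ) : Prop := ∃ t : ℝ, G (a * t) ∧ G (b * t) ∧ G (c * t) ∧ G (d * t)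

lemma lemmaB (a b c e : ℤ) (hc : IsCoprime c 3) (s : ℝ) (ha : G (a * s)) (hb : G (b * s)) (n : ℤ)
    (hn : |e * s - n| ≤ 1 / 6) : W (3 * a) (3 * b) c (c + 3 * e) := by
  have h := abs_le.1 hn
  have key : ∀ u : ℝ, 1 / 4 ≤ u → u + 1 / 3 ≤ 3 / 4 → 1 / 4 ≤ u + (e * s - n) →
      u + 1 / 3 + (e * s - n) ≤ 3 / 4 → W (3 * a) (3 * b) c (c + 3 * e) := by
    intro u h1 h2 h3 h4
    obtain ⟨k, m, h5, h6⟩ := cover (c * (s / 3)) u c 3 (by norm_num) hc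
    push_cast at h5 h6
    refine ⟨(s + k) / 3, ha.of_eq (a * k) ?_, hb.of_eq (b * k) ?_, ⟨m, ?_, ?_⟩,
      ⟨m + n + e * k, ?_, ?_⟩⟩
    · push_cast; ring
    · push_cast; ring
    · have : (c : ℝ) * ((s + k) / 3) = c * (s / 3) + c * k / 3 := by ring
      rw [this]; linarith
    · have : (c : ℝ) * ((s + k) / 3) = c * (s / 3) + c * k / 3 := by ring
      rw [this]; linarith
    · have : ((c + 3 * e : ℤ) : ℝ) * ((s + k) / 3) = c * (s / 3) + c * k / 3 + e * s + e * k := by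
        push_cast; ring
      rw [this]; push_cast; linarith
    · have : ((c + 3 * e : ℤ) : ℝ) * ((s + k) / 3) = c * (s / 3) + c * k / 3 + e * s + e * k := by
        push_cast; ring
      rw [this]; push_cast; linarith
  rcases le_total 0 (e * s - n : ℝ) with h0 | h0
  · exact key (1 / 4) (by norm_num) (by norm_num) (by linarith) (by linarith [h.2])
  · exact key (5 / 12) (by norm_num) (by norm_num) (by linarith [h.1]) (by linarith)

lemma lemmaC (γ c : ℤ) (hγ : 0 < γ) (hc : IsCoprime c (3 * γ)) :
    W (3 * (2 * γ)) (3 * (7 * γ)) c (c + 3 * γ) := by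
  obtain ⟨X, Y, hXY⟩ := hc
  obtain ⟨j, hj1, hj2⟩ : ∃ j : ℤ, 21 * γ ≤ 5 * c + 28 * j ∧ 5 * c + 28 * j ≤ 48 * γ :=
    ⟨-((5 * c - 21 * γ) / 28), by omega, by omega⟩
  have hγR : (0 : ℝ) < γ := by exact_mod_cast hγ
  have e : (X : ℝ) * c + Y * (3 * γ) = 1 := by exact_mod_cast hXY
  have j1 : (21 : ℝ) * γ ≤ 5 * c + 28 * j := by exact_mod_cast hj1
  have j2 : (5 : ℝ) * c + 28 * j ≤ 48 * γ := by exact_mod_cast hj2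
  have k1 : (1 : ℝ) / 4 ≤ (5 * c + 28 * j) / (84 * γ) := by
    rw [le_div_iff₀ (by positivity)]; linarith
  have k2 : ((5 : ℝ) * c + 28 * j) / (84 * γ) ≤ 4 / 7 := by
    rw [div_le_iff₀ (by positivity)]; linarith
  have ec : (c : ℝ) * ((5 / 28 + X * j) / (3 * γ)) = (5 * c + 28 * j) / (84 * γ) - Y * j := by
    field_simp
    linear_combination 2352 * (j : ℝ) * e
  have ed : ((c + 3 * γ : ℤ) : ℝ) * ((5 / 28 + X * j) / (3 * γ)) =
      (5 * c + 28 * j) / (84 * γ) - Y * j + 5 / 28 + X * j := by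
    have : ((c + 3 * γ : ℤ) : ℝ) * ((5 / 28 + X * j) / (3 * γ)) =
      (c : ℝ) * ((5 / 28 + X * j) / (3 * γ)) + 5 / 28 + X * j := by
      push_cast; field_simp; ring
    rw [this, ec]
  refine ⟨(5 / 28 + X * j) / (3 * γ), ⟨2 * X * j, ?_, ?_⟩, ⟨7 * X * j + 1, ?_, ?_⟩,
    ⟨-(Y * j), ?_, ?_⟩, ⟨-(Y * j) + X * j, ?_, ?_⟩⟩
  · have : ((3 * (2 * γ) : ℤ) : ℝ) * ((5 / 28 + X * j) / (3 * γ)) = 10 / 28 + 2 * X * j := by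
      push_cast; field_simp; ring
    rw [this]; push_cast; linarith
  · have : ((3 * (2 * γ) : ℤ) : ℝ) * ((5 / 28 + X * j) / (3 * γ)) = 10 / 28 + 2 * X * j := by
      push_cast; field_simp; ring
    rw [this]; push_cast; linarith
  · have : ((3 * (7 * γ) : ℤ) : ℝ) * ((5 / 28 + X * j) / (3 * γ)) = 5 / 4 + 7 * X * j := by
      push_cast; field_simp; ring
    rw [this]; push_cast; linarith
  · have : ((3 * (7 * γ) : ℤ) : ℝ) * ((5 / 28 + X * j) / (3 * γ)) = 5 / 4 + 7 * X * j := by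
      push_cast; field_simp; ring
    rw [this]; push_cast; linarith
  · rw [ec]; push_cast; linarith
  · rw [ec]; push_cast; linarith
  · rw [ed]; push_cast; linarith
  · rw [ed]; push_cast; linarith

lemma lemma3 (b z : ℤ) (hb : 0 < b) (hz : 0 < z) (h : IsCoprime b z) :
    ∃ σ : ℝ, G (b * σ) ∧ ∃ n : ℤ, 1 / 4 ≤ z * σ - n ∧ z * σ - n ≤ 1 / 3 := by
  by_cases h1 : z = 1
  · subst h1
    by_cases h4 : 4 ∣ b
    · by_cases h3 : 3 ∣ b
      · have hb12 : (12 : ℝ) ≤ b := by exact_mod_cast (by omega : 12 ≤ b)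
        obtain ⟨b', hb'⟩ := h4
        have hbR : (b : ℝ) = 4 * b' := by exact_mod_cast hb'
        have hb0 : (0 : ℝ) < b := by linarith
        have e : (b : ℝ) * (1 / 4 + 1 / (4 * b)) = b' + 1 / 4 := by
          rw [mul_add, hbR]
          have : (b' : ℝ) ≠ 0 := by intro h; rw [h] at hbR; linarith
          field_simp
        have h12 : 1 / (4 * (b : ℝ)) ≤ 1 / 12 := by
          rw [div_le_div_iff₀ (by positivity) (by norm_num)]; linarith
        have h0 : 0 ≤ 1 / (4 * (b : ℝ)) := by positivity
        refine ⟨1 / 4 + 1 / (4 * b), ⟨b', ?_, ?_⟩, 0, ?_, ?_⟩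
        · rw [e]
        · rw [e]; linarith
        · push_cast; linarith
        · push_cast; linarith
      · refine ⟨1 / 3, ?_, 0, by norm_num, by norm_num⟩
        have : ∃ q : ℤ, b = 3 * q + 1 ∨ b = 3 * q + 2 := ⟨b / 3, by omega⟩
        obtain ⟨q, rfl | rfl⟩ := this
        · exact ⟨q, by push_cast; linarith, by push_cast; linarith⟩
        · exact ⟨q, by push_cast; linarith, by push_cast; linarith⟩
    · refine ⟨1 / 4, ?_, 0, by norm_num, by norm_num⟩
      have : ∃ q : ℤ, b = 4 * q + 1 ∨ b = 4 * q + 2 ∨ b = 4 * q + 3 := ⟨b / 4, by omega⟩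
      obtain ⟨q, rfl | rfl | rfl⟩ := this
      · exact ⟨q, by push_cast; linarith, by push_cast; linarith⟩
      · exact ⟨q, by push_cast; linarith, by push_cast; linarith⟩
      · exact ⟨q, by push_cast; linarith, by push_cast; linarith⟩
  · have hzR : (0 : ℝ) < z := by exact_mod_cast hz
    obtain ⟨j, hj⟩ := shiftZ (b * (1 / 4 / z)) b z hz (by
      intro hd
      have := h.isUnit_of_dvd' hd dvd_rfl
      rcases Int.isUnit_iff.1 this with h | h <;> omega)
    have e : (z : ℝ) * ((1 / 4 + j) / z) - ((j : ℤ) : ℝ) = 1 / 4 := by push_cast; field_simp; ring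
    refine ⟨(1 / 4 + j) / z, hj.of_eq 0 ?_, j, ?_, ?_⟩
    · push_cast; ring
    · rw [e]
    · rw [e]; norm_num

/-- `gcd (c, z) > 1`. -/
lemma caseD1 (c z b h : ℤ) (hc : c ≠ 0) (hz : z ≠ 0) (hd : c + z ≠ 0) (hh : 0 < h)
    (h1 : h ∣ c) (h2 : h ∣ z) (h3 : ¬ h ∣ b) : W z b c (c + z) := by
  obtain ⟨t, g1, g2, g3⟩ := lr3Z z c (c + z) hz hc hd
  obtain ⟨j, hj⟩ := shiftZ (b * t) b h hh h3
  obtain ⟨c1, rfl⟩ := h1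
  obtain ⟨z1, rfl⟩ := h2
  have hR : (0 : ℝ) < h := by exact_mod_cast hh
  refine ⟨t + j / h, g1.of_eq (z1 * j) ?_, hj.of_eq 0 ?_, g2.of_eq (c1 * j) ?_,
    g3.of_eq ((c1 + z1) * j) ?_⟩
  · push_cast; field_simp
  · push_cast; ring
  · push_cast; field_simp
  · push_cast; field_simp

/-- `gcd (b, e) > 1`. -/
lemma caseD2 (c b1 z1 g : ℤ) (hb : 0 < b1) (hz : 0 < z1) (h : IsCoprime b1 z1) (hg : 2 ≤ g)
    (hc : IsCoprime c (3 * g)) : W (3 * (g * z1)) (3 * (g * b1)) c (c + 3 * (g * z1)) := by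
  obtain ⟨σ, h1, n, h2, h3⟩ := lemma3 b1 z1 hb hz h
  obtain ⟨k, m, h4, h5⟩ := cover (c * (σ / (3 * g))) (1 / 4) c (3 * g) (by omega) hc
  have hgR : (2 : ℝ) ≤ g := by exact_mod_cast hg
  have hg0 : (0 : ℝ) < g := by linarith
  have h6 : 1 / ((3 * g : ℤ) : ℝ) ≤ 1 / 6 := by
    push_cast
    rw [div_le_div_iff₀ (by positivity) (by norm_num)]; linarith
  have ez : ((3 * (g * z1) : ℤ) : ℝ) * ((σ + k) / (3 * g)) = z1 * σ + z1 * k := by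
    push_cast; field_simp
  have eb : ((3 * (g * b1) : ℤ) : ℝ) * ((σ + k) / (3 * g)) = b1 * σ + b1 * k := by
    push_cast; field_simp
  have ec : (c : ℝ) * ((σ + k) / (3 * g)) = c * (σ / (3 * g)) + c * k / ((3 * g : ℤ) : ℝ) := by
    push_cast; field_simp
  refine ⟨(σ + k) / (3 * g), ⟨n + z1 * k, ?_, ?_⟩, h1.of_eq (b1 * k) ?_, ⟨m, ?_, ?_⟩,
    ⟨m + n + z1 * k, ?_, ?_⟩⟩
  · rw [ez]; push_cast; linarith
  · rw [ez]; push_cast; linarith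
  · rw [eb]; push_cast; ring
  · rw [ec]; linarith
  · rw [ec]; linarith
  · rw [Int.cast_add c, add_mul, ez, ec]; push_cast at *; linarith
  · rw [Int.cast_add c, add_mul, ez, ec]; push_cast at *; linarith

/-- `e ≥ 4`. -/
lemma caseD3 (c b e : ℤ) (he : 4 ≤ e) (hbe : IsCoprime b e) (hc : IsCoprime c (3 * e)) :
    W (3 * e) (3 * b) c (c + 3 * e) := by
  obtain ⟨X, Y, hXY⟩ := hc
  have heR : (0 : ℝ) < e := by exact_mod_cast (by omega : 0 < e)
  have E : (X : ℝ) * c + Y * (3 * e) = 1 := by exact_mod_cast hXY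
  obtain ⟨r, w, hr, hr2⟩ := balanced (b * X) e (by omega)
  have hr' : (b : ℝ) * X = r + e * w := by exact_mod_cast hr
  have hr0 : r ≠ 0 := by
    rintro rfl
    have h1 : IsCoprime X e := ⟨c, 3 * Y, by linarith⟩
    have h2 : IsCoprime (b * X) e := IsCoprime.mul_left hbe h1
    rw [hr, zero_add] at h2
    have : IsUnit e := h2.isUnit_of_dvd' ⟨w, rfl⟩ dvd_rfl
    rcases Int.isUnit_iff.1 this with h | h <;> omega
  by_contra hc
  obtain ⟨j0, hj0⟩ : ∃ j0 : ℤ, j0 = -((c - 3 * e) / 4) := ⟨_, rfl⟩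
  obtain ⟨N, hN⟩ : ∃ N : ℕ, (N : ℤ) = (6 * e - c) / 4 - j0 :=
    ⟨((6 * e - c) / 4 - j0).toNat, by omega⟩
  have hδ : |(r : ℝ) / e| ≤ 1 / 2 := by
    rw [abs_div, abs_of_pos heR, div_le_div_iff₀ heR (by norm_num)]
    have : (2 : ℝ) * |(r : ℝ)| ≤ e := by exact_mod_cast hr2
    linarith
  have key := prog (ρ := b / (4 * e) + j0 * (r / e)) hδ N (by
    intro i hi hG
    apply hc
    obtain ⟨j, hj⟩ : ∃ j : ℤ, j = j0 + i := ⟨_, rfl⟩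
    have hjR : (j : ℝ) = j0 + i := by exact_mod_cast hj
    have q1 : (3 : ℝ) * e ≤ c + 4 * j := by exact_mod_cast (by omega : 3 * e ≤ c + 4 * j)
    have q2 : (c : ℝ) + 4 * j ≤ 6 * e := by exact_mod_cast (by omega : c + 4 * j ≤ 6 * e)
    have k1 : 1 / 4 ≤ ((c : ℝ) + 4 * j) / (12 * e) := by
      rw [le_div_iff₀ (by positivity)]; linarith
    have k2 : ((c : ℝ) + 4 * j) / (12 * e) ≤ 1 / 2 := by
      rw [div_le_iff₀ (by positivity)]; linarith
    have ec : (c : ℝ) * ((1 / 4 + X * j) / (3 * e)) = (c + 4 * j) / (12 * e) - Y * j := by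
      field_simp
      linear_combination 48 * (j : ℝ) * E
    have ez : ((3 * e : ℤ) : ℝ) * ((1 / 4 + X * j) / (3 * e)) = 1 / 4 + X * j := by
      push_cast; field_simp
    refine ⟨(1 / 4 + X * j) / (3 * e), ⟨X * j, ?_, ?_⟩, hG.of_eq (w * j) ?_,
      ⟨-(Y * j), ?_, ?_⟩, ⟨-(Y * j) + X * j, ?_, ?_⟩⟩
    · rw [ez]; push_cast; linarith
    · rw [ez]; push_cast; linarith
    · have : ((3 * b : ℤ) : ℝ) * ((1 / 4 + X * j) / (3 * e)) = (b / 4 + (b * X) * j) / e := by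
        push_cast; field_simp
      rw [this, hr', hjR]; push_cast; rw [hjR]; field_simp; ring
    · rw [ec]; push_cast; linarith
    · rw [ec]; push_cast; linarith
    · rw [Int.cast_add c, add_mul, ez, ec]; push_cast; linarith
    · rw [Int.cast_add c, add_mul, ez, ec]; push_cast; linarith)
  rw [abs_div, abs_of_pos heR, mul_div_assoc', div_lt_div_iff₀ heR (by norm_num)] at key
  have h7 : N * |r| * 2 < e := by
    have : (N : ℝ) * |(r : ℝ)| * 2 < 1 * e := key
    rw [one_mul] at this
    exact_mod_cast this
  have h8 : (N : ℤ) * 1 ≤ N * |r| :=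
    mul_le_mul_of_nonneg_left (by have := abs_pos.2 hr0; omega) (by positivity)
  omega

set_option maxRecDepth 100000 in
set_option synthInstance.maxHeartbeats 1000000 in
set_option synthInstance.maxSize 100000 in
lemma res9 : ∀ c ∈ Finset.range 36, ∀ b ∈ Finset.range 12, c % 3 ≠ 0 → b % 3 ≠ 0 → ∃ p ∈ Finset.range 36,
    (36 ≤ 4 * (9 * p % 36) ∧ 4 * (9 * p % 36) ≤ 3 * 36) ∧
    (36 ≤ 4 * (3 * b * p % 36) ∧ 4 * (3 * b * p % 36) ≤ 3 * 36) ∧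
    (36 ≤ 4 * (c * p % 36) ∧ 4 * (c * p % 36) ≤ 3 * 36) ∧
    (36 ≤ 4 * ((c + 9) * p % 36) ∧ 4 * ((c + 9) * p % 36) ≤ 3 * 36) := by
  decide +kernel

set_option maxRecDepth 100000 in
set_option synthInstance.maxHeartbeats 1000000 in
set_option synthInstance.maxSize 100000 in
lemma res6 : ∀ c ∈ Finset.range 24, ∀ b ∈ Finset.range 8, c % 3 ≠ 0 → c % 2 = 1 → b % 2 = 1 →
    ¬ ((c + 3) % 4 = 0 ∧ ((b + 16 * 8) % 8 = (c + 3 + 3) % 8 ∨ (b + 3) % 8 = (c + 3) % 8)) →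
    ∃ p ∈ Finset.range 24,
    (24 ≤ 4 * (6 * p % 24) ∧ 4 * (6 * p % 24) ≤ 3 * 24) ∧
    (24 ≤ 4 * (3 * b * p % 24) ∧ 4 * (3 * b * p % 24) ≤ 3 * 24) ∧
    (24 ≤ 4 * (c * p % 24) ∧ 4 * (c * p % 24) ≤ 3 * 24) ∧
    (24 ≤ 4 * ((c + 6) * p % 24) ∧ 4 * ((c + 6) * p % 24) ≤ 3 * 24) := by
  decide +kernel

set_option maxRecDepth 100000 in
set_option synthInstance.maxHeartbeats 1000000 in
set_option synthInstance.maxSize 100000 in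
lemma res3 : ∀ c ∈ Finset.range 12, ∀ b ∈ Finset.range 4, c % 3 ≠ 0 → b % 4 ≠ 0 → ∃ p ∈ Finset.range 12,
    (12 ≤ 4 * (3 * p % 12) ∧ 4 * (3 * p % 12) ≤ 3 * 12) ∧
    (12 ≤ 4 * (3 * b * p % 12) ∧ 4 * (3 * b * p % 12) ≤ 3 * 12) ∧
    (12 ≤ 4 * (c * p % 12) ∧ 4 * (c * p % 12) ≤ 3 * 12) ∧
    (12 ≤ 4 * ((c + 3) * p % 12) ∧ 4 * ((c + 3) * p % 12) ≤ 3 * 12) := by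
  decide +kernel

lemma caseZ9 (c b : ℤ) (hc : ¬ 3 ∣ c) (hb : ¬ 3 ∣ b) : W 9 (3 * b) c (c + 9) := by
  obtain ⟨c0, hc0⟩ : ∃ c0 : ℕ, (c0 : ℤ) = c % 36 := ⟨(c % 36).toNat, by omega⟩
  obtain ⟨b0, hb0⟩ : ∃ b0 : ℕ, (b0 : ℤ) = b % 12 := ⟨(b % 12).toNat, by omega⟩
  obtain ⟨p, _, h1, h2, h3, h4⟩ := res9 c0 (by rw [Finset.mem_range]; omega) b0
    (by rw [Finset.mem_range]; omega) (by omega) (by omega)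
  exact ⟨p / (36 : ℕ), G_of_res 9 9 p 36 (by norm_num) (by norm_num) h1.1 h1.2,
    G_of_res _ _ p 36 (by push_cast; omega) (by norm_num) h2.1 h2.2,
    G_of_res _ _ p 36 (by push_cast; omega) (by norm_num) h3.1 h3.2,
    G_of_res _ _ p 36 (by push_cast; omega) (by norm_num) h4.1 h4.2⟩

lemma caseZ6a (c b : ℤ) (hc : ¬ 3 ∣ c) (hc2 : ¬ 2 ∣ c) (hb : ¬ 2 ∣ b)
    (hn : ¬ (4 ∣ c + 3 ∧ (8 ∣ b - (c + 3) - 3 ∨ 8 ∣ b - (c + 3) + 3))) : W 6 (3 * b) c (c + 6) := by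
  obtain ⟨c0, hc0⟩ : ∃ c0 : ℕ, (c0 : ℤ) = c % 24 := ⟨(c % 24).toNat, by omega⟩
  obtain ⟨b0, hb0⟩ : ∃ b0 : ℕ, (b0 : ℤ) = b % 8 := ⟨(b % 8).toNat, by omega⟩
  obtain ⟨p, _, h1, h2, h3, h4⟩ := res6 c0 (by rw [Finset.mem_range]; omega) b0
    (by rw [Finset.mem_range]; omega) (by omega) (by omega)
    (by omega) (by omega)
  exact ⟨p / (24 : ℕ), G_of_res 6 6 p 24 (by norm_num) (by norm_num) h1.1 h1.2,
    G_of_res _ _ p 24 (by push_cast; omega) (by norm_num) h2.1 h2.2,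
    G_of_res _ _ p 24 (by push_cast; omega) (by norm_num) h3.1 h3.2,
    G_of_res _ _ p 24 (by push_cast; omega) (by norm_num) h4.1 h4.2⟩

lemma caseZ3a (c b : ℤ) (hc : ¬ 3 ∣ c) (hb : ¬ 4 ∣ b) : W 3 (3 * b) c (c + 3) := by
  obtain ⟨c0, hc0⟩ : ∃ c0 : ℕ, (c0 : ℤ) = c % 12 := ⟨(c % 12).toNat, by omega⟩
  obtain ⟨b0, hb0⟩ : ∃ b0 : ℕ, (b0 : ℤ) = b % 4 := ⟨(b % 4).toNat, by omega⟩
  obtain ⟨p, _, h1, h2, h3, h4⟩ := res3 c0 (by rw [Finset.mem_range]; omega) b0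
    (by rw [Finset.mem_range]; omega) (by omega) (by omega)
  exact ⟨p / (12 : ℕ), G_of_res 3 3 p 12 (by norm_num) (by norm_num) h1.1 h1.2,
    G_of_res _ _ p 12 (by push_cast; omega) (by norm_num) h2.1 h2.2,
    G_of_res _ _ p 12 (by push_cast; omega) (by norm_num) h3.1 h3.2,
    G_of_res _ _ p 12 (by push_cast; omega) (by norm_num) h4.1 h4.2⟩

/-- Sufficient condition when the difference is `6`. -/
lemma lemE (c b J M : ℤ) (ζ : ℝ) (h3 : ¬ 3 ∣ c) (h2 : ¬ 2 ∣ c) (hb : ¬ 2 ∣ b) (z1 : 1 / 4 ≤ ζ)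
    (z2 : ζ ≤ 1 / 2) (hu : |((c : ℝ) + 3) * ζ + J| ≤ 3 / 2 - 3 * ζ)
    (hM : |(b : ℝ) * ζ + J - 2 * M| ≤ 1 / 2) : W 6 (3 * b) c (c + 6) := by
  obtain ⟨q, hq⟩ : ∃ q, c * c = 1 + 6 * q := by
    have : ∃ n, c = 6 * n + 1 ∨ c = 6 * n + 5 := ⟨c / 6, by omega⟩
    obtain ⟨n, rfl | rfl⟩ := this
    · exact ⟨6 * n * n + 2 * n, by ring⟩
    · exact ⟨6 * n * n + 10 * n + 4, by ring⟩
  obtain ⟨r, hr⟩ : ∃ r, c = 2 * r + 1 := ⟨c / 2, by omega⟩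
  obtain ⟨s, hs⟩ : ∃ s, b = 2 * s + 1 := ⟨b / 2, by omega⟩
  obtain ⟨x, hx⟩ : ∃ x, b * (c * (J + 3)) = J + 1 + 2 * x :=
    ⟨s * (c * (J + 3)) + r * (J + 3) + 1, by rw [hs, hr]; ring⟩
  have hqR : (c : ℝ) * c = 1 + 6 * q := by exact_mod_cast hq
  have hxR : (b : ℝ) * (c * (J + 3)) = J + 1 + 2 * x := by exact_mod_cast hx
  rw [abs_le] at hu hM
  refine ⟨(c * (J + 3) + ζ) / 6, ⟨c * (J + 3), ?_, ?_⟩, ⟨M + x, ?_, ?_⟩,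
    ⟨q * (J + 3), ?_, ?_⟩, ⟨q * (J + 3) + c * (J + 3), ?_, ?_⟩⟩
  · push_cast; linarith
  · push_cast; linarith
  · push_cast; linarith
  · push_cast; linarith
  all_goals
    have e : (c : ℝ) * ((c * (J + 3) + ζ) / 6) = (J + 3 + c * ζ) / 6 + q * (J + 3) := by
      linear_combination ((J : ℝ) + 3) / 6 * hqR
    push_cast
    try rw [add_mul]
    rw [e]
    linarith

lemma lemE' (c b w i M N : ℤ) (τ : ℝ) (h3 : ¬ 3 ∣ c) (h2 : ¬ 2 ∣ c) (hb : ¬ 2 ∣ b)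
    (hw : c + 3 = 4 * w) (hbM : b = c + 6 + 8 * M) (t0 : 0 ≤ τ) (t1 : τ ≤ 1 / 4)
    (hu : |((c : ℝ) + 3) * τ + i| ≤ 3 / 4 - 3 * τ)
    (hM : |3 / 4 + (b : ℝ) * τ + i - 2 * N| ≤ 1 / 2) : W 6 (3 * b) c (c + 6) := by
  have hwR : (c : ℝ) + 3 = 4 * w := by exact_mod_cast hw
  have hbR : (b : ℝ) = c + 6 + 8 * M := by exact_mod_cast hbM
  apply lemE c b (-w + i) (M + N) (1 / 4 + τ) h3 h2 hb (by linarith) (by linarith)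
  · have : ((c : ℝ) + 3) * (1 / 4 + τ) + ((-w + i : ℤ) : ℝ) = (c + 3) * τ + i := by
      push_cast; linarith
    rw [this]; linarith
  · have : (b : ℝ) * (1 / 4 + τ) + ((-w + i : ℤ) : ℝ) - 2 * ((M + N : ℤ) : ℝ)
        = 3 / 4 + (b : ℝ) * τ + i - 2 * N := by
      push_cast; linarith
    rw [this]; exact hM

lemma caseZ6b' (c b : ℤ) (h3 : ¬ 3 ∣ c) (h2 : ¬ 2 ∣ c) (hb : ¬ 2 ∣ b)
    (hw : 4 ∣ c + 3) (hbM : 8 ∣ b - (c + 6)) : W 6 (3 * b) c (c + 6) := by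
  obtain ⟨w, hw⟩ := hw
  obtain ⟨M, hM⟩ := hbM
  obtain ⟨u, hu⟩ : ∃ u, u = c + 3 := ⟨_, rfl⟩
  have huR : (c : ℝ) + 3 = u := by exact_mod_cast hu.symm
  obtain ⟨U, hU⟩ : ∃ U, U = |u| := ⟨_, rfl⟩
  have hw0 : w ≠ 0 := by rintro rfl; exact h3 ⟨-1, by omega⟩
  have hU4 : 4 ≤ U := by clear h3; rw [hU]; rcases abs_cases u with h | h <;> omega
  have hUR : |(u : ℝ)| = U := by rw [hU, Int.cast_abs]
  have hU4R : (4 : ℝ) ≤ U := by exact_mod_cast hU4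
  have key := lemE' c b w
  rw [huR] at key
  have habs : |u| = U := hU.symm
  -- cases with `i = 0`
  have big : ∀ B x : ℝ, 0 < B → x ≤ 3 → x ≤ B → 0 ≤ x → x * (U + 3) ≤ 3 * B →
      (0 ≤ x / (4 * B) ∧ x / (4 * B) ≤ 1 / 4 ∧
      |(u : ℝ) * (x / (4 * B)) + ((0 : ℤ) : ℝ)| ≤ 3 / 4 - 3 * (x / (4 * B))) := by
    intro B x hB hx3 hx hx0 hxU
    have p0 : 0 ≤ x / (4 * B) := by positivity
    refine ⟨p0, ?_, ?_⟩
    · rw [div_le_div_iff₀ (by positivity) (by norm_num)]; linarith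
    · rw [Int.cast_zero, add_zero, abs_mul, hUR, abs_of_nonneg p0]
      have : (U + 3) * (x / (4 * B)) ≤ 3 / 4 := by
        rw [mul_div_assoc', div_le_div_iff₀ (by positivity) (by norm_num)]; linarith
      linarith
  -- cases with `i = - sign u`
  have small : ∃ τ : ℝ, τ = 1 / (4 * (U - 3)) ∧ 0 ≤ τ ∧ τ ≤ 1 / 4 ∧ (U - 3) * τ = 1 / 4 ∧
      U * τ ≤ 1 := by
    have : (0 : ℝ) < U - 3 := by linarith
    have e : ((U : ℝ) - 3) * (1 / (4 * (U - 3))) = 1 / 4 := by field_simp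
    have l : 1 / (4 * ((U : ℝ) - 3)) ≤ 1 / 4 := by
      rw [div_le_div_iff₀ (by positivity) (by norm_num)]; linarith
    exact ⟨_, rfl, by positivity, l, e, by linarith⟩
  obtain ⟨τ, -, s0, s1, s2, s3⟩ := small
  have smallcase : (-(U - 3) ≤ b ∧ b ≤ 3 * (U - 3)) → W 6 (3 * b) c (c + 6) := by
    rintro ⟨k1, k2⟩
    have k1R : -((U : ℝ) - 3) ≤ b := by exact_mod_cast k1
    have k2R : (b : ℝ) ≤ 3 * ((U : ℝ) - 3) := by exact_mod_cast k2
    have k3 : -(((U : ℝ) - 3) * τ) ≤ b * τ := by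
      have := mul_le_mul_of_nonneg_right k1R s0
      linarith
    have k4 : b * τ ≤ 3 * (((U : ℝ) - 3) * τ) := by
      have := mul_le_mul_of_nonneg_right k2R s0
      linarith
    rcases abs_cases u with ⟨h, h'⟩ | ⟨h, h'⟩
    · have e : (u : ℝ) = U := by exact_mod_cast (by omega : u = U)
      refine key (-1) M 0 τ h3 h2 hb hw (by omega) s0 s1 ?_ ?_
      · rw [e, abs_le]; push_cast; constructor <;> linarith
      · rw [abs_le]; push_cast; constructor <;> linarith
    · have e : (u : ℝ) = -U := by exact_mod_cast (by omega : u = -U)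
      refine key 1 M 1 τ h3 h2 hb hw (by omega) s0 s1 ?_ ?_
      · rw [e, abs_le]; push_cast; constructor <;> linarith
      · rw [abs_le]; push_cast; constructor <;> linarith
  rcases lt_trichotomy b 0 with hb0 | hb0 | hb0
  · by_cases h : U + 3 ≤ 3 * (-b)
    · have hR : (U : ℝ) + 3 ≤ 3 * (-b) := by exact_mod_cast h
      have hB : (0 : ℝ) < -b := by linarith
      have hB1 : (1 : ℝ) ≤ -b := by linarith
      obtain ⟨p, q, r⟩ := big (-b) 1 hB (by norm_num) hB1 (by norm_num) (by linarith)
      refine key 0 M 0 _ h3 h2 hb hw (by omega) p q r ?_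
      have : (b : ℝ) * (1 / (4 * -b)) = -1 / 4 := by
        have : (b : ℝ) ≠ 0 := by linarith
        field_simp
      rw [this]; push_cast; rw [abs_le]; constructor <;> linarith
    · apply smallcase
      rcases abs_cases u with h | h <;> omega
  · omega
  · by_cases h : U + 3 ≤ b
    · have hR : (U : ℝ) + 3 ≤ b := by exact_mod_cast h
      have hB : (0 : ℝ) < b := by linarith
      obtain ⟨p, q, r⟩ := big b 3 hB (by norm_num) (by linarith) (by norm_num) (by linarith)
      refine key 0 M 1 _ h3 h2 hb hw (by omega) p q r ?_
      have : (b : ℝ) * (3 / (4 * b)) = 3 / 4 := by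
        field_simp
      rw [this]; push_cast; rw [abs_le]; constructor <;> linarith
    · apply smallcase
      rcases abs_cases u with h | h <;> omega

lemma caseZ6 (c b : ℤ) (h3 : ¬ 3 ∣ c) (h2 : ¬ 2 ∣ c) (hb : ¬ 2 ∣ b) : W 6 (3 * b) c (c + 6) := by
  by_cases hn : 4 ∣ c + 3 ∧ (8 ∣ b - (c + 3) - 3 ∨ 8 ∣ b - (c + 3) + 3)
  · obtain ⟨h4, h8 | h8⟩ := hn
    · exact caseZ6b' c b h3 h2 hb h4 (by omega)
    · obtain ⟨t, g1, g2, g3, g4⟩ := caseZ6b' c (-b) h3 h2 (by omega) h4 (by omega)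
      refine ⟨t, g1, g2.neg.of_eq 0 ?_, g3, g4⟩
      push_cast; ring
  · exact caseZ6a c b h3 h2 hb hn

/-- Sufficient condition when the difference is `3`. -/
lemma lemF (c m n : ℤ) (τ : ℝ) (h3 : ¬ 3 ∣ c) (t0 : 0 ≤ τ) (t1 : τ ≤ 1 / 4)
    (hA : (n : ℝ) ≤ ((2 * c + 3 : ℝ) - 1) / 8 + ((2 * c + 3) - 3) * τ / 2)
    (hB : ((2 * c + 3 : ℝ) - 7) / 8 + ((2 * c + 3) + 3) * τ / 2 ≤ n)
    (hG : G (4 * m * τ)) : W 3 (3 * (4 * m)) c (c + 3) := by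
  obtain ⟨q, hq⟩ : ∃ q, c * c = 1 + 3 * q := by
    have : ∃ n, c = 3 * n + 1 ∨ c = 3 * n + 2 := ⟨c / 3, by omega⟩
    obtain ⟨n, rfl | rfl⟩ := this
    · exact ⟨3 * n * n + 2 * n, by ring⟩
    · exact ⟨3 * n * n + 4 * n + 1, by ring⟩
  have hqR : (c : ℝ) * c = 1 + 3 * q := by exact_mod_cast hq
  have e : (c : ℝ) * ((c * (1 - n) + (1 / 4 + τ)) / 3)
      = ((1 - n) + c * (1 / 4 + τ)) / 3 + q * (1 - n) := by
    linear_combination (1 - (n : ℝ)) / 3 * hqR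
  refine ⟨(c * (1 - n) + (1 / 4 + τ)) / 3, ⟨c * (1 - n), ?_, ?_⟩,
    hG.of_eq (4 * m * (c * (1 - n)) + m) ?_,
    ⟨q * (1 - n), ?_, ?_⟩, ⟨q * (1 - n) + c * (1 - n), ?_, ?_⟩⟩
  · push_cast; linarith
  · push_cast; linarith
  · push_cast; ring
  · rw [e]; push_cast; linarith
  · rw [e]; push_cast; linarith
  · rw [Int.cast_add c, add_mul, e]; push_cast; linarith
  · rw [Int.cast_add c, add_mul, e]; push_cast; linarith

lemma caseZ3b (c m : ℤ) (h3 : ¬ 3 ∣ c) (hm : 0 < m) (hc : 1 ≤ c) :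
    W 3 (3 * (4 * m)) c (c + 3) := by
  obtain ⟨f, hf⟩ : ∃ f, f = 2 * c + 3 := ⟨_, rfl⟩
  have hfR : (2 : ℝ) * c + 3 = f := by exact_mod_cast hf.symm
  have key := lemF c m
  rw [hfR] at key
  have hm1 : (1 : ℝ) ≤ m := by exact_mod_cast hm
  have hm0 : (0 : ℝ) < m := by linarith
  have hf5 : (5 : ℝ) ≤ f := by exact_mod_cast (by omega : 5 ≤ f)
  obtain ⟨τ0, hτ⟩ : ∃ τ0 : ℝ, τ0 = 1 / (16 * m) := ⟨_, rfl⟩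
  have m0 : (m : ℝ) * τ0 = 1 / 16 := by rw [hτ]; field_simp
  have p0 : 0 < τ0 := by rw [hτ]; positivity
  have p1 : τ0 ≤ 1 / 16 := by
    rw [hτ, div_le_div_iff₀ (by positivity) (by norm_num)]; linarith
  have G0 : G (4 * m * τ0) := ⟨0, by push_cast; linarith, by push_cast; linarith⟩
  by_cases h1 : 4 * m + 6 ≤ f
  · have h1R : (4 : ℝ) * m + 6 ≤ f := by exact_mod_cast h1
    obtain ⟨n, hn⟩ : ∃ n, n = ⌊((f : ℝ) - 1) / 8 + (f - 3) * τ0 / 2⌋ := ⟨_, rfl⟩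
    have n1 := Int.floor_le (((f : ℝ) - 1) / 8 + (f - 3) * τ0 / 2)
    have n2 := Int.lt_floor_add_one (((f : ℝ) - 1) / 8 + (f - 3) * τ0 / 2)
    rw [← hn] at n1 n2
    by_cases hB : ((f : ℝ) - 7) / 8 + (f + 3) * τ0 / 2 ≤ n
    · exact key n τ0 h3 p0.le (by linarith) n1 hB G0
    · push Not at hB
      have hf3 : (0 : ℝ) < f - 3 := by linarith
      obtain ⟨τ, hτ1⟩ : ∃ τ : ℝ, (f - 3) * τ = 2 * (n + 1 - (f - 1) / 8) :=
        ⟨2 * (n + 1 - (f - 1) / 8) / (f - 3), by field_simp⟩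
      have a1 : τ0 ≤ τ := by
        refine le_of_mul_le_mul_left ?_ hf3
        linarith
      have a2 : τ ≤ 3 * τ0 := by
        refine le_of_mul_le_mul_left ?_ hf3
        have : (4 * m) * τ0 ≤ (f - 6) * τ0 := mul_le_mul_of_nonneg_right (by linarith) p0.le
        linarith
      refine key (n + 1) τ h3 (by linarith) (by linarith) ?_ ?_ ⟨0, ?_, ?_⟩
      · push_cast; linarith
      · push_cast; linarith
      · have := mul_le_mul_of_nonneg_left a1 hm0.le
        push_cast; linarith
      · have := mul_le_mul_of_nonneg_left a2 hm0.le
        push_cast; linarith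
  · have bd : ∀ k : ℤ, f + 3 ≤ k * m → (f + 3 : ℝ) * τ0 ≤ k / 16 := by
      intro k hk
      have hkR : (f : ℝ) + 3 ≤ k * m := by exact_mod_cast hk
      have := mul_le_mul_of_nonneg_right hkR p0.le
      calc (f + 3 : ℝ) * τ0 ≤ k * m * τ0 := this
        _ = k * (m * τ0) := by ring
        _ = k / 16 := by rw [m0]; ring
    have pf : 0 ≤ ((f : ℝ) - 3) * τ0 := mul_nonneg (by linarith) p0.le
    have hq : ∃ q, f = 8 * q + 1 ∨ f = 8 * q + 3 ∨ f = 8 * q + 5 ∨ f = 8 * q + 7 :=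
      ⟨f / 8, by omega⟩
    obtain ⟨q, h | h | h | h⟩ := hq
    · have hR : (f : ℝ) = 8 * q + 1 := by exact_mod_cast h
      have := bd 24 (by omega)
      push_cast at this
      exact key q τ0 h3 p0.le (by linarith) (by linarith) (by linarith) G0
    · have hR : (f : ℝ) = 8 * q + 3 := by exact_mod_cast h
      have := bd 16 (by omega)
      push_cast at this
      exact key q τ0 h3 p0.le (by linarith) (by linarith) (by linarith) G0
    · have hR : (f : ℝ) = 8 * q + 5 := by exact_mod_cast h
      have := bd 8 (by omega)
      push_cast at this
      exact key q τ0 h3 p0.le (by linarith) (by linarith) (by linarith) G0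
    · have hR : (f : ℝ) = 8 * q + 7 := by exact_mod_cast h
      by_cases hs : f = 7 ∧ m = 1
      · have e1 : (f : ℝ) = 7 := by exact_mod_cast hs.1
        have e2 : (m : ℝ) = 1 := by exact_mod_cast hs.2
        refine key (q + 1) (1 / 8) h3 (by norm_num) (by norm_num) ?_ ?_ ⟨0, ?_, ?_⟩
        · push_cast; linarith
        · push_cast; linarith
        · rw [e2]; norm_num
        · rw [e2]; norm_num
      · have ineq : f * f - 9 ≤ 4 * m * (3 * f - 15) := by
          by_cases h7 : f = 7
          · subst h7; omega
          · have : f - 5 ≤ 4 * m := by omega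
            have h15 : 15 ≤ f := by omega
            nlinarith
        have iR : (f : ℝ) * f - 9 ≤ 4 * m * (3 * f - 15) := by exact_mod_cast ineq
        have f3 : (0 : ℝ) < f - 3 := by linarith
        have f3' : (0 : ℝ) < f + 3 := by linarith
        have L : 4 * m * (1 / (2 * (f - 3))) + 1 / 2 ≤ (4 * m * (2 / (f + 3)) : ℝ) := by
          have : (4 * m * (2 / (f + 3)) : ℝ) - (4 * m * (1 / (2 * (f - 3))) + 1 / 2)
              = (4 * m * (3 * f - 15) - (f * f - 9)) / (2 * (f + 3) * (f - 3)) := by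
            field_simp; ring
          have h0 : (0 : ℝ) ≤ (4 * m * (3 * f - 15) - (f * f - 9)) / (2 * (f + 3) * (f - 3)) :=
            div_nonneg (by linarith) (by positivity)
          linarith
        obtain ⟨z, l1, l2, gz⟩ := G_interval L
        have ez : 4 * m * (z / (4 * m)) = z := by field_simp
        have m4 : (0 : ℝ) < 4 * m := by linarith
        have l3 : 1 / (2 * (f - 3)) ≤ z / (4 * m) := by
          rw [le_div_iff₀ m4]; linarith
        have l4 : z / (4 * m) ≤ 2 / (f + 3) := by
          rw [div_le_iff₀ m4]; linarith
        have l5 : 1 / 2 ≤ (f - 3) * (z / (4 * m)) := by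
          rw [div_le_iff₀ (by positivity)] at l3; linarith
        have l6 : (f + 3) * (z / (4 * m)) ≤ 2 := by
          rw [le_div_iff₀ f3'] at l4; linarith
        have l7 : 2 / ((f : ℝ) + 3) ≤ 1 / 4 := by
          rw [div_le_div_iff₀ f3' (by norm_num)]; linarith
        have l8 : 0 ≤ 1 / (2 * ((f : ℝ) - 3)) := by positivity
        refine key (q + 1) (z / (4 * m)) h3 (by linarith) (by linarith) ?_ ?_ (by rw [ez]; exact gz)
        · push_cast; linarith
        · push_cast; linarith

lemma caseZ3 (c b : ℤ) (h3 : ¬ 3 ∣ c) (hb : 0 < b) :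
    W 3 (3 * b) c (c + 3) ∨ (4 ∣ b ∧ (c = -1 ∨ c = -2)) := by
  by_cases h4 : 4 ∣ b
  · obtain ⟨m, rfl⟩ := h4
    rcases lt_or_ge c (-3) with h | h
    · left
      obtain ⟨t, g1, g2, g3, g4⟩ := caseZ3b (-c - 3) m (by omega) (by omega) (by omega)
      refine ⟨t, g1, g2, g4.neg.of_eq 0 ?_, g3.neg.of_eq 0 ?_⟩
      · push_cast; ring
      · push_cast; ring
    · by_cases h' : 1 ≤ c
      · left; exact caseZ3b c m h3 (by omega) h'
      · right; exact ⟨⟨m, rfl⟩, by omega⟩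
  · left; exact caseZ3a c b h3 h4

lemma lemmaD (c b e : ℤ) (hb : 0 < b) (he : 0 < e) (hbe : b ≠ e) (h3 : ¬ 3 ∣ c)
    (hg : ∀ n : ℤ, n ∣ 3 * e → n ∣ 3 * b → n ∣ c → IsUnit n) :
    W (3 * e) (3 * b) c (c + 3 * e) ∨ (e = 1 ∧ 4 ∣ b ∧ (c = -1 ∨ c = -2)) := by
  by_cases hce : IsCoprime c (3 * e)
  swap
  · left
    have hne : Int.gcd c (3 * e) ≠ 1 := fun h => hce (Int.isCoprime_iff_gcd_eq_one.2 h)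
    have hpos : 0 < Int.gcd c (3 * e) := Int.gcd_pos_of_ne_zero_right _ (by omega)
    refine caseD1 c (3 * e) (3 * b) (Int.gcd c (3 * e)) ?_ ?_ ?_ (by exact_mod_cast hpos)
      (Int.gcd_dvd_left ..) (Int.gcd_dvd_right ..) ?_
    · rintro rfl; exact h3 (dvd_zero 3)
    · omega
    · intro h; exact h3 ⟨-e, by omega⟩
    · intro h
      have := hg _ (Int.gcd_dvd_right ..) h (Int.gcd_dvd_left ..)
      rcases Int.isUnit_iff.1 this with h | h <;> omega
  by_cases hbc : IsCoprime b e
  swap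
  · left
    have hne : Int.gcd b e ≠ 1 := fun h => hbc (Int.isCoprime_iff_gcd_eq_one.2 h)
    have hpos : 0 < Int.gcd b e := Int.gcd_pos_of_ne_zero_right _ (by omega)
    obtain ⟨g, hgg⟩ : ∃ g : ℤ, g = Int.gcd b e := ⟨_, rfl⟩
    obtain ⟨b1, hb1⟩ : g ∣ b := hgg ▸ Int.gcd_dvd_left ..
    obtain ⟨z1, hz1⟩ : g ∣ e := hgg ▸ Int.gcd_dvd_right ..
    have hg0 : 0 < g := by omega
    have hcop : IsCoprime b1 z1 := by
      rw [Int.isCoprime_iff_gcd_eq_one]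
      have h1 : Int.gcd (b / g) (e / g) = 1 := by
        rw [hgg]; exact Int.gcd_ediv_gcd_ediv_gcd hpos
      rwa [hb1, hz1, Int.mul_ediv_cancel_left _ hg0.ne', Int.mul_ediv_cancel_left _ hg0.ne'] at h1
    have hbp : 0 < b1 := by
      rw [hb1] at hb; exact (mul_pos_iff_of_pos_left hg0).1 hb
    have hzp : 0 < z1 := by
      rw [hz1] at he; exact (mul_pos_iff_of_pos_left hg0).1 he
    rw [hb1, hz1]
    refine caseD2 c b1 z1 g hbp hzp hcop (by omega) ?_
    refine hce.of_isCoprime_of_dvd_right ?_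
    exact ⟨z1, by rw [hz1]; ring⟩
  by_cases h4 : 4 ≤ e
  · left; exact caseD3 c b e h4 hbc hce
  have : e = 1 ∨ e = 2 ∨ e = 3 := by omega
  rcases this with rfl | rfl | rfl
  · rcases caseZ3 c b h3 hb with h | h
    · left; exact h
    · right; exact ⟨rfl, h⟩
  · left
    refine caseZ6 c b h3 ?_ ?_
    · intro h
      have := hce.isUnit_of_dvd' h (by norm_num)
      rcases Int.isUnit_iff.1 this with h | h <;> omega
    · intro h
      have := hbc.isUnit_of_dvd' h (by norm_num)
      rcases Int.isUnit_iff.1 this with h | h <;> omega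
  · left
    refine caseZ9 c b h3 ?_
    intro h
    have := hbc.isUnit_of_dvd' h (by norm_num)
    rcases Int.isUnit_iff.1 this with h | h <;> omega

lemma W.swap {a b c d : ℤ} (h : W a b c d) : W b a c d := by
  obtain ⟨t, h1, h2, h3, h4⟩ := h
  exact ⟨t, h2, h1, h3, h4⟩

lemma W.swap' {a b c d : ℤ} (h : W a b c d) : W a b d c := by
  obtain ⟨t, h1, h2, h3, h4⟩ := h
  exact ⟨t, h1, h2, h4, h3⟩

lemma W.neg4 {a b c d : ℤ} (h : W a b c (-d)) : W a b c d := by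
  obtain ⟨t, h1, h2, h3, h4⟩ := h
  refine ⟨t, h1, h2, h3, h4.neg.of_eq 0 ?_⟩
  push_cast; ring

lemma cop3 (c : ℤ) (h3 : ¬ 3 ∣ c) : IsCoprime c 3 := by
  have : ∃ n, c = 3 * n + 1 ∨ c = 3 * n + 2 := ⟨c / 3, by omega⟩
  obtain ⟨n, rfl | rfl⟩ := this
  · exact ⟨1, -n, by ring⟩
  · exact ⟨-1, n + 1, by ring⟩

lemma M2 (a b c e : ℤ) (ha : 0 < a) (hb : 0 < b) (hab : a ≠ b) (he : 0 < e) (h3 : ¬ 3 ∣ c)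
    (hg : ∀ n : ℤ, n ∣ 3 * a → n ∣ 3 * b → n ∣ c → n ∣ c + 3 * e → IsUnit n) :
    W (3 * a) (3 * b) c (c + 3 * e) ∨
      (((a = 1 ∧ 4 ∣ b) ∨ (b = 1 ∧ 4 ∣ a)) ∧ e = 1 ∧ (c = -1 ∨ c = -2)) := by
  by_cases h1 : a = e
  · subst h1
    rcases lemmaD c b a hb ha hab.symm h3
      (fun n n1 n2 n3 => hg n n1 n2 n3 (dvd_add n3 n1)) with h | ⟨h, h', h''⟩
    · exact Or.inl h
    · exact Or.inr ⟨Or.inl ⟨h, h'⟩, h, h''⟩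
  by_cases h2 : b = e
  · subst h2
    rcases lemmaD c a b ha hb hab h3
      (fun n n1 n2 n3 => hg n n2 n1 n3 (dvd_add n3 n1)) with h | ⟨h, h', h''⟩
    · exact Or.inl h.swap
    · exact Or.inr ⟨Or.inr ⟨h, h'⟩, h, h''⟩
  left
  have hcop : (e ∣ a ∧ e ∣ b) → IsCoprime c (3 * e) := by
    rintro ⟨d1, d2⟩
    rw [Int.isCoprime_iff_gcd_eq_one]
    have n1 := Int.gcd_dvd_left (a := c) (b := 3 * e)
    have n2 := Int.gcd_dvd_right (a := c) (b := 3 * e)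
    have := hg _ (n2.trans (mul_dvd_mul_left 3 d1)) (n2.trans (mul_dvd_mul_left 3 d2)) n1
      (dvd_add n1 n2)
    rcases Int.isUnit_iff.1 this with h | h <;> omega
  by_cases h4 : a = 2 * e ∧ b = 7 * e
  · obtain ⟨rfl, rfl⟩ := h4
    exact lemmaC e c he (hcop ⟨⟨2, by ring⟩, ⟨7, by ring⟩⟩)
  by_cases h5 : a = 7 * e ∧ b = 2 * e
  · obtain ⟨rfl, rfl⟩ := h5
    exact (lemmaC e c he (hcop ⟨⟨7, by ring⟩, ⟨2, by ring⟩⟩)).swap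
  obtain ⟨s, g1, g2, n, hn⟩ := lemmaA a b e ha hb he h1 h2 h4 h5
  exact lemmaB a b c e (cop3 c h3) s g1 g2 n hn

lemma M3 (a b c d : ℤ) (ha : 0 < a) (hb : 0 < b) (hab : a ≠ b) (hcd : c ≠ d) (h3 : ¬ 3 ∣ c)
    (hd : 3 ∣ d - c)
    (hg : ∀ n : ℤ, n ∣ 3 * a → n ∣ 3 * b → n ∣ c → n ∣ d → IsUnit n) :
    W (3 * a) (3 * b) c d ∨
      (((a = 1 ∧ 4 ∣ b) ∨ (b = 1 ∧ 4 ∣ a)) ∧ ((c = -1 ∧ d = 2) ∨ (c = -2 ∧ d = 1) ∨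
        (c = 2 ∧ d = -1) ∨ (c = 1 ∧ d = -2))) := by
  obtain ⟨e, he⟩ := hd
  rcases lt_or_gt_of_ne hcd with h | h
  · obtain rfl : d = c + 3 * e := by omega
    rcases M2 a b c e ha hb hab (by omega) h3 hg with h | ⟨h, h', h''⟩
    · exact Or.inl h
    · exact Or.inr ⟨h, by omega⟩
  · obtain rfl : c = d + 3 * (-e) := by omega
    rcases M2 a b d (-e) ha hb hab (by omega) (by omega)
      (fun n n1 n2 n3 n4 => hg n n1 n2 n4 n3) with h | ⟨h, h', h''⟩
    · exact Or.inl h.swap'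
    · exact Or.inr ⟨h, by omega⟩

/-- Three of the speeds divisible by three. -/
lemma T3 (a b c d : ℤ) (ha : a ≠ 0) (hb : b ≠ 0) (hc : c ≠ 0) (h3 : ¬ 3 ∣ d)
    (ka : 3 ∣ a) (kb : 3 ∣ b) (kc : 3 ∣ c) : W a b c d := by
  obtain ⟨t, g1, g2, g3⟩ := lr3Z a b c ha hb hc
  obtain ⟨k, n, h1, h2⟩ := cover (d * t) (1 / 4) d 3 (by norm_num) (cop3 d h3)
  obtain ⟨a, rfl⟩ := ka
  obtain ⟨b, rfl⟩ := kb
  obtain ⟨c, rfl⟩ := kc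
  push_cast at h1 h2
  refine ⟨t + k / 3, g1.of_eq (a * k) ?_, g2.of_eq (b * k) ?_, g3.of_eq (c * k) ?_, n, ?_, ?_⟩
  · push_cast; ring
  · push_cast; ring
  · push_cast; ring
  · have : (d : ℝ) * (t + k / 3) = d * t + d * k / 3 := by ring
    rw [this]; linarith
  · have : (d : ℝ) * (t + k / 3) = d * t + d * k / 3 := by ring
    rw [this]; linarith

lemma main4 (a b c d : ℕ) (ha : 0 < a) (hb : 0 < b) (hc : 0 < c) (hd : 0 < d) (hab : a ≠ b)
    (hcd : c ≠ d) (ka : 3 ∣ a) (kb : 3 ∣ b)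
    (hg : ∀ n : ℕ, n ∣ a → n ∣ b → n ∣ c → n ∣ d → n = 1) :
    W a b c d ∨ (((a = 3 ∧ 12 ∣ b) ∨ (b = 3 ∧ 12 ∣ a)) ∧
      ((c = 1 ∧ d = 2) ∨ (c = 2 ∧ d = 1))) := by
  by_cases kc : 3 ∣ c
  · left
    refine T3 a b c d (by omega) (by omega) (by omega) ?_ (by omega) (by omega) (by omega)
    intro h
    have := hg 3 ka kb kc (by omega)
    omega
  by_cases kd : 3 ∣ d
  · left
    exact (T3 a b d c (by omega) (by omega) (by omega) (by omega) (by omega) (by omega)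
      (by omega)).swap'
  obtain ⟨a, rfl⟩ := ka
  obtain ⟨b, rfl⟩ := kb
  have hg' : ∀ n : ℤ, n ∣ 3 * a → n ∣ 3 * b → n ∣ c → n ∣ d → IsUnit n := by
    intro n n1 n2 n3 n4
    rw [Int.isUnit_iff_natAbs_eq]
    refine hg _ ?_ ?_ ?_ ?_
    · exact Int.natCast_dvd_natCast.1 (Int.natAbs_dvd.2 (by exact_mod_cast n1))
    · exact Int.natCast_dvd_natCast.1 (Int.natAbs_dvd.2 (by exact_mod_cast n2))
    · exact Int.natCast_dvd_natCast.1 (Int.natAbs_dvd.2 n3)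
    · exact Int.natCast_dvd_natCast.1 (Int.natAbs_dvd.2 n4)
  push_cast
  by_cases hs : (3 : ℤ) ∣ d - c
  · rcases M3 a b c d (by omega) (by omega) (by omega) (by omega) (by omega) hs hg' with h | ⟨h, h'⟩
    · exact Or.inl h
    · right; omega
  · have hs' : (3 : ℤ) ∣ -d - c := by
      have r1 : c % 3 = 1 ∨ c % 3 = 2 := by omega
      have r2 : d % 3 = 1 ∨ d % 3 = 2 := by omega
      rcases r1 with r1 | r1 <;> rcases r2 with r2 | r2 <;> omega
    rcases M3 a b c (-d) (by omega) (by omega) (by omega) (by omega) (by omega) hs'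
      (fun n n1 n2 n3 n4 => hg' n n1 n2 n3 ((dvd_neg).1 n4)) with h | ⟨h, h'⟩
    · exact Or.inl h.neg4
    · right; omega


lemma dnn_of_G {x : ℝ} (h : G x) : 1 / 4 ≤ dnn x := by
  obtain ⟨m, h1, h2⟩ := h
  refine le_ciInf fun k => ?_
  rcases le_or_gt k m with hk | hk
  · have : (k : ℝ) ≤ m := by exact_mod_cast hk
    exact le_trans (by linarith) (le_abs_self _)
  · have : (m : ℝ) + 1 ≤ k := by exact_mod_cast hk
    exact le_trans (by linarith) (neg_le_abs _)

lemma dnn_le (x : ℝ) : dnn x ≤ 1 / 2 := by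
  have hb : BddBelow (Set.range fun m : ℤ => |x - m|) := ⟨0, by
    rintro _ ⟨m, rfl⟩; exact abs_nonneg _⟩
  exact (ciInf_le hb (round x)).trans (abs_sub_round x)

lemma ML_of_W (a b c d : ℕ) (h : W a b c d) :
    1 / 4 ≤ ML ![(a : ℝ), (b : ℝ), (c : ℝ), (d : ℝ)] := by
  obtain ⟨t, h1, h2, h3, h4⟩ := h
  push_cast at h1 h2 h3 h4
  have hb : BddAbove (Set.range fun t : ℝ =>
      ⨅ i, dnn (t * (![(a : ℝ), (b : ℝ), (c : ℝ), (d : ℝ)] : Fin 4 → ℝ) i)) := by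
    refine ⟨1 / 2, ?_⟩
    rintro _ ⟨s, rfl⟩
    exact (ciInf_le (Set.finite_range _).bddBelow (0 : Fin 4)).trans (dnn_le _)
  refine le_trans ?_ (le_ciSup hb t)
  refine le_ciInf fun i => ?_
  apply dnn_of_G
  rw [mul_comm]
  fin_cases i
  · exact h1
  · exact h2
  · exact h3
  · exact h4

theorem stmt_11 (v₁ v₂ v₃ v₄ : ℕ) (h₁ : 0 < v₁)
    (h₁₂ : v₁ < v₂) (h₂₃ : v₂ < v₃) (h₃₄ : v₃ < v₄)
    (hgcd : Nat.gcd (Nat.gcd (Nat.gcd v₁ v₂) v₃) v₄ = 1)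
    (hpair : (3 ∣ v₁ ∧ 3 ∣ v₂) ∨ (3 ∣ v₁ ∧ 3 ∣ v₃) ∨ (3 ∣ v₁ ∧ 3 ∣ v₄) ∨
      (3 ∣ v₂ ∧ 3 ∣ v₃) ∨ (3 ∣ v₂ ∧ 3 ∣ v₄) ∨ (3 ∣ v₃ ∧ 3 ∣ v₄)) :
    ML ![(v₁ : ℝ), (v₂ : ℝ), (v₃ : ℝ), (v₄ : ℝ)] ≥ 1 / 4 ∨
      (v₁ = 1 ∧ v₂ = 2 ∧ v₃ = 3 ∧ ∃ k : ℕ, 0 < k ∧ v₄ = 12 * k) := by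
  have hg : ∀ n : ℕ, n ∣ v₁ → n ∣ v₂ → n ∣ v₃ → n ∣ v₄ → n = 1 := fun n a b c d =>
    Nat.dvd_one.1 (hgcd ▸ Nat.dvd_gcd (Nat.dvd_gcd (Nat.dvd_gcd a b) c) d)
  suffices h : W v₁ v₂ v₃ v₄ ∨ (v₁ = 1 ∧ v₂ = 2 ∧ v₃ = 3 ∧ 12 ∣ v₄) by
    rcases h with h | ⟨e1, e2, e3, k, hk⟩
    · exact Or.inl (ML_of_W _ _ _ _ h)
    · exact Or.inr ⟨e1, e2, e3, k, by omega, hk⟩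
  rcases hpair with ⟨p, q⟩ | ⟨p, q⟩ | ⟨p, q⟩ | ⟨p, q⟩ | ⟨p, q⟩ | ⟨p, q⟩
  · rcases main4 v₁ v₂ v₃ v₄ (by omega) (by omega) (by omega) (by omega) (by omega) (by omega) p q
      (fun n a b c d => hg n a b c d) with ⟨t, a, b, c, d⟩ | h
    · exact Or.inl ⟨t, a, b, c, d⟩
    · exfalso; omega
  · rcases main4 v₁ v₃ v₂ v₄ (by omega) (by omega) (by omega) (by omega) (by omega) (by omega) p q
      (fun n a b c d => hg n a c b d) with ⟨t, a, b, c, d⟩ | h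
    · exact Or.inl ⟨t, a, c, b, d⟩
    · exfalso; omega
  · rcases main4 v₁ v₄ v₂ v₃ (by omega) (by omega) (by omega) (by omega) (by omega) (by omega) p q
      (fun n a b c d => hg n a c d b) with ⟨t, a, b, c, d⟩ | h
    · exact Or.inl ⟨t, a, c, d, b⟩
    · exfalso; omega
  · rcases main4 v₂ v₃ v₁ v₄ (by omega) (by omega) (by omega) (by omega) (by omega) (by omega) p q
      (fun n a b c d => hg n c a b d) with ⟨t, a, b, c, d⟩ | h
    · exact Or.inl ⟨t, c, a, b, d⟩
    · exfalso; omega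
  · rcases main4 v₂ v₄ v₁ v₃ (by omega) (by omega) (by omega) (by omega) (by omega) (by omega) p q
      (fun n a b c d => hg n c a d b) with ⟨t, a, b, c, d⟩ | h
    · exact Or.inl ⟨t, c, a, d, b⟩
    · exfalso; omega
  · rcases main4 v₃ v₄ v₁ v₂ (by omega) (by omega) (by omega) (by omega) (by omega) (by omega) p q
      (fun n a b c d => hg n c d a b) with ⟨t, a, b, c, d⟩ | h
    · exact Or.inl ⟨t, c, d, a, b⟩
    · right; omega
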